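/- arXiv:1101.4305 — 3 statements merged into one kernel-verified Lean document; each statement's English description precedes it below -/
import Mathlib

section
/- Let x and y be elements of the first Weyl algebra A₁ over a field K of characteristic zero with [y,x] = 1, and let A₁' := K⟨x,y⟩ be the subalgebra generated by x and y. Then Frac(A₁') ∩ A₁ = A₁', where Frac denotes the skew field of fractions and the intersection is taken inside Frac(A₁). -/
def weylRel (K : Type*) [CommRing K] :
    FreeAlgebra K (Fin 2) → FreeAlgebra K (Fin 2) → Prop :=
  fun a b => a = FreeAlgebra.ι K 1 * FreeAlgebra.ι K 0 ∧
    b = FreeAlgebra.ι K 0 * FreeAlgebra.ι K 1 + 1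

/-- The first Weyl algebra `A₁ = K⟨X, Y | YX - XY = 1⟩` over `K`,
realized as the quotient of the free algebra on two generators `X, Y`
by the relation `Y * X = X * Y + 1`. -/
abbrev WeylAlgebra (K : Type*) [CommRing K] := RingQuot (weylRel K)

namespace WA
set_option linter.unusedSimpArgs false
open MvPolynomial

section basics
variable {R : Type*} [CommRing R]

noncomputable def gX (R : Type*) [CommRing R] : WeylAlgebra R :=
  RingQuot.mkAlgHom R (weylRel R) (FreeAlgebra.ι R 0)
noncomputable def gY (R : Type*) [CommRing R] : WeylAlgebra R :=
  RingQuot.mkAlgHom R (weylRel R) (FreeAlgebra.ι R 1)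

lemma gY_mul_gX : gY R * gX R = gX R * gY R + 1 := by
  have := RingQuot.mkAlgHom_rel R (s := weylRel R) (x := FreeAlgebra.ι R 1 * FreeAlgebra.ι R 0)
    (y := FreeAlgebra.ι R 0 * FreeAlgebra.ι R 1 + 1) ⟨rfl, rfl⟩
  simpa [gX, gY] using this

noncomputable def lift {B : Type*} [Ring B] [Algebra R B] (x y : B) (h : y * x = x * y + 1) :
    WeylAlgebra R →ₐ[R] B :=
  RingQuot.liftAlgHom R ⟨FreeAlgebra.lift R ![x, y], by
    rintro _ _ ⟨rfl, rfl⟩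
    simp [h]⟩

@[simp] lemma lift_gX {B : Type*} [Ring B] [Algebra R B] (x y : B) (h : y * x = x * y + 1) :
    lift (R := R) x y h (gX R) = x := by
  simp [lift, gX]

@[simp] lemma lift_gY {B : Type*} [Ring B] [Algebra R B] (x y : B) (h : y * x = x * y + 1) :
    lift (R := R) x y h (gY R) = y := by
  simp [lift, gY]

lemma hom_ext {B : Type*} [Ring B] [Algebra R B] {f g : WeylAlgebra R →ₐ[R] B}
    (h0 : f (gX R) = g (gX R)) (h1 : f (gY R) = g (gY R)) : f = g := by
  apply RingQuot.ringQuot_ext'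
  apply FreeAlgebra.hom_ext
  funext i
  fin_cases i
  · exact h0
  · exact h1

lemma adjoin_gen : Algebra.adjoin R ({gX R, gY R} : Set (WeylAlgebra R)) = ⊤ := by
  have h1 : (Algebra.adjoin R (Set.range (FreeAlgebra.ι R (X := Fin 2)))) = ⊤ :=
    FreeAlgebra.adjoin_range_ι R (Fin 2)
  have h2 : (⊤ : Subalgebra R (FreeAlgebra R (Fin 2))).map (RingQuot.mkAlgHom R (weylRel R)) = ⊤ := by
    rw [Algebra.map_top, AlgHom.range_eq_top]
    exact RingQuot.mkAlgHom_surjective R _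
  rw [← h2, ← h1, AlgHom.map_adjoin]
  congr 1
  ext z
  simp [Set.mem_image, gX, gY, Fin.exists_fin_two, eq_comm]

lemma lift_range {B : Type*} [Ring B] [Algebra R B] (x y : B) (h : y * x = x * y + 1) :
    (lift (R := R) x y h).range = Algebra.adjoin R {x, y} := by
  rw [← Algebra.map_top, ← adjoin_gen, AlgHom.map_adjoin]
  congr 1
  simp [Set.image_pair]

/-- operator representation -/
noncomputable def rho (R : Type*) [CommRing R] :
    WeylAlgebra R →ₐ[R] Module.End R (MvPolynomial (Fin 2) R) :=
  lift (LinearMap.mulLeft R (X 0)) ((pderiv 0).toLinearMap + LinearMap.mulLeft R (X 1)) (by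
    apply LinearMap.ext
    intro f
    simp [pderiv_X_self]
    ring)

@[simp] lemma rho_gX (f : MvPolynomial (Fin 2) R) : rho R (gX R) f = X 0 * f := by
  simp [rho]

@[simp] lemma rho_gY (f : MvPolynomial (Fin 2) R) : rho R (gY R) f = pderiv 0 f + X 1 * f := by
  simp [rho]

lemma gY_mul_gX_pow (n : ℕ) : gY R * gX R ^ n = gX R ^ n * gY R + n • gX R ^ (n - 1) := by
  induction n with
  | zero => simp
  | succ n ih =>
    rw [pow_succ, ← mul_assoc, ih, add_mul, mul_assoc, gY_mul_gX]
    rcases n with _ | n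
    · simp
    · simp only [Nat.add_sub_cancel, smul_mul_assoc, ← pow_succ]
      simp only [add_smul, one_smul, mul_add, mul_one, ← mul_assoc, ← pow_succ]
      abel

noncomputable def mon (R : Type*) [CommRing R] (m : Fin 2 →₀ ℕ) : WeylAlgebra R :=
  gX R ^ m 0 * gY R ^ m 1

noncomputable def tau (R : Type*) [CommRing R] : MvPolynomial (Fin 2) R →ₗ[R] WeylAlgebra R :=
  (basisMonomials (Fin 2) R).constr R (mon R)

lemma tau_monomial (m : Fin 2 →₀ ℕ) (c : R) : tau R (monomial m c) = c • mon R m := by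
  have : monomial m c = c • basisMonomials (Fin 2) R m := by
    simp [smul_monomial]
  rw [this, map_smul, tau, Module.Basis.constr_basis]

noncomputable def sig (R : Type*) [CommRing R] : WeylAlgebra R →ₗ[R] MvPolynomial (Fin 2) R :=
  (LinearMap.applyₗ (1 : MvPolynomial (Fin 2) R)).comp (rho R).toLinearMap

lemma sig_apply (a : WeylAlgebra R) : sig R a = rho R a 1 := rfl

lemma sig_mul (a b : WeylAlgebra R) : sig R (a * b) = rho R a (sig R b) := by
  simp [sig_apply]

lemma rho_gY_pow_one (n : ℕ) : rho R (gY R ^ n) 1 = X 1 ^ n := by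
  induction n with
  | zero => simp
  | succ n ih =>
    rw [pow_succ', map_mul, Module.End.mul_apply, ih, rho_gY]
    simp [Derivation.leibniz_pow, pderiv_X_of_ne]
    ring

lemma rho_gX_pow (n : ℕ) (f : MvPolynomial (Fin 2) R) : rho R (gX R ^ n) f = X 0 ^ n * f := by
  induction n with
  | zero => simp
  | succ n ih =>
    rw [pow_succ', map_mul, Module.End.mul_apply, ih, rho_gX]
    ring

lemma monomial_eq' (m : Fin 2 →₀ ℕ) : (monomial m (1 : R)) = X 0 ^ m 0 * X 1 ^ m 1 := by
  rw [monomial_eq]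
  simp [Finsupp.prod_fintype]

lemma sig_mon (m : Fin 2 →₀ ℕ) : sig R (mon R m) = monomial m 1 := by
  rw [sig_apply, mon, map_mul, Module.End.mul_apply, rho_gY_pow_one, rho_gX_pow, monomial_eq']

lemma sig_tau (f : MvPolynomial (Fin 2) R) : sig R (tau R f) = f := by
  induction f using MvPolynomial.induction_on' with
  | monomial m c => rw [tau_monomial, map_smul, sig_mon, smul_monomial, smul_eq_mul, mul_one]
  | add p q hp hq => rw [map_add, map_add, hp, hq]

lemma tau_surj : Function.Surjective (tau R) := by
  have key : ∀ a b : WeylAlgebra R, b ∈ LinearMap.range (tau R) → a * b ∈ LinearMap.range (tau R) := by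
    intro a
    have ha : a ∈ Algebra.adjoin R ({gX R, gY R} : Set (WeylAlgebra R)) := by
      rw [adjoin_gen]; trivial
    have hm : ∀ i j : ℕ, gX R ^ i * gY R ^ j ∈ LinearMap.range (tau R) := by
      intro i j
      refine ⟨monomial (Finsupp.single 0 i + Finsupp.single 1 j) 1, ?_⟩
      rw [tau_monomial]
      simp [mon]
    have aux : ∀ c : WeylAlgebra R, (∀ m, c * mon R m ∈ LinearMap.range (tau R)) →
        ∀ b ∈ LinearMap.range (tau R), c * b ∈ LinearMap.range (tau R) := by
      rintro c hc _ ⟨f, rfl⟩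
      induction f using MvPolynomial.induction_on' with
      | monomial m r =>
        rw [tau_monomial, mul_smul_comm]
        exact Submodule.smul_mem _ _ (hc m)
      | add p q hp hq => rw [map_add, mul_add]; exact Submodule.add_mem _ hp hq
    induction ha using Algebra.adjoin_induction with
    | mem c hc =>
      apply aux
      intro m
      rcases hc with rfl | rfl
      · rw [mon, ← mul_assoc, ← pow_succ']
        exact hm _ _
      · rw [mon, ← mul_assoc, gY_mul_gX_pow, add_mul, mul_assoc, ← pow_succ', smul_mul_assoc]
        exact Submodule.add_mem _ (hm _ _) (Submodule.smul_of_tower_mem _ _ (hm _ _))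
    | algebraMap r =>
      intro b hb
      rw [← Algebra.smul_def]
      exact Submodule.smul_mem _ _ hb
    | add c d _ _ hc hd => intro b hb; rw [add_mul]; exact Submodule.add_mem _ (hc b hb) (hd b hb)
    | mul c d _ _ hc hd => intro b hb; rw [mul_assoc]; exact hc _ (hd b hb)
  intro a
  have h1 : (1 : WeylAlgebra R) ∈ LinearMap.range (tau R) :=
    ⟨monomial 0 1, by rw [tau_monomial]; simp [mon]⟩
  simpa using key a 1 h1

lemma tau_sig (a : WeylAlgebra R) : tau R (sig R a) = a := by
  obtain ⟨f, rfl⟩ := tau_surj a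
  rw [sig_tau]

lemma sig_inj : Function.Injective (sig R) := Function.LeftInverse.injective tau_sig

/-- linear induction principle -/
lemma weyl_induction {P : WeylAlgebra R → Prop} (hm : ∀ m (c : R), P (c • mon R m))
    (ha : ∀ a b, P a → P b → P (a + b)) (a : WeylAlgebra R) : P a := by
  obtain ⟨f, rfl⟩ := tau_surj a
  induction f using MvPolynomial.induction_on' with
  | monomial m r => rw [tau_monomial]; exact hm _ _
  | add p q hp hq => rw [map_add]; exact ha _ _ hp hq

lemma rho_comm_X1 (a : WeylAlgebra R) (f : MvPolynomial (Fin 2) R) :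
    rho R a (X 1 * f) = X 1 * rho R a f := by
  have ha : a ∈ Algebra.adjoin R ({gX R, gY R} : Set (WeylAlgebra R)) := by
    rw [adjoin_gen]; trivial
  induction ha using Algebra.adjoin_induction generalizing f with
  | mem c hc =>
    rcases hc with rfl | rfl
    · simp; ring
    · simp [pderiv_X_of_ne]; ring
  | algebraMap r => simp [Algebra.smul_def]; ring
  | add c d _ _ hc hd => simp [hc, hd]; ring
  | mul c d _ _ hc hd => simp [hc, hd]

lemma rho_X0 (a : WeylAlgebra R) :
    rho R a (X 0) = X 0 * rho R a 1 + pderiv 1 (rho R a 1) := by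
  induction a using weyl_induction with
  | hm m c =>
    have e : (X 0 : MvPolynomial (Fin 2) R) = sig R (gX R) := by simp [sig_apply]
    have hY : ∀ n : ℕ, rho R (gY R ^ n) (X 0) = X 0 * X 1 ^ n + (n : MvPolynomial (Fin 2) R) * X 1 ^ (n-1) := by
      intro n
      induction n with
      | zero => simp
      | succ n ih =>
        rw [pow_succ', map_mul, Module.End.mul_apply, ih, rho_gY]
        rcases n with _ | n
        · simp [add_comm, mul_comm]
        · simp [Derivation.leibniz_pow, pderiv_X_of_ne]
          ring
    simp only [mon, map_smul, LinearMap.smul_apply, map_mul (rho R), Module.End.mul_apply, hY, rho_gX_pow, rho_gY_pow_one]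
    simp [Derivation.leibniz_pow, pderiv_X_of_ne, smul_eq_C_mul]
    ring
  | ha a b ha hb => simp [ha, hb]; ring

lemma sig_comm_Y (a : WeylAlgebra R) : sig R (gY R * a - a * gY R) = pderiv 0 (sig R a) := by
  rw [map_sub, sig_mul, sig_mul, rho_gY]
  have : sig R (gY R) = X 1 * 1 := by simp [sig_apply]
  rw [this, rho_comm_X1, sig_apply]
  ring

lemma sig_comm_X (a : WeylAlgebra R) : sig R (a * gX R - gX R * a) = pderiv 1 (sig R a) := by
  rw [map_sub, sig_mul, sig_mul, rho_gX]
  have : sig R (gX R) = X 0 := by simp [sig_apply]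
  rw [this, rho_X0, sig_apply]
  ring

lemma sig_one : sig R 1 = 1 := by simp [sig_apply]

lemma sig_algebraMap (c : R) : sig R (algebraMap R _ c) = C c := by
  rw [Algebra.algebraMap_eq_smul_one, map_smul, sig_one, smul_eq_C_mul, mul_one]

end basics
end WA

namespace WA
open MvPolynomial

section degree
variable {R : Type*} [CommRing R]

/-- `f` has degree at most `n` with leading form `g`. -/
def Lead (n : ℕ) (f g : MvPolynomial (Fin 2) R) : Prop :=
  f.totalDegree ≤ n ∧ homogeneousComponent n f = g

lemma lead_self (f : MvPolynomial (Fin 2) R) {n : ℕ} (h : f.totalDegree ≤ n) :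
    Lead n f (homogeneousComponent n f) := ⟨h, rfl⟩

lemma Lead.add {n : ℕ} {f g f' g' : MvPolynomial (Fin 2) R} (h : Lead n f g) (h' : Lead n f' g') :
    Lead n (f + f') (g + g') :=
  ⟨(totalDegree_add _ _).trans (max_le h.1 h'.1), by rw [map_add, h.2, h'.2]⟩

lemma lead_of_lt {n : ℕ} {f : MvPolynomial (Fin 2) R} (h : f.totalDegree < n) : Lead n f 0 :=
  ⟨h.le, homogeneousComponent_eq_zero _ _ h⟩

lemma Lead.smul {n : ℕ} {f g : MvPolynomial (Fin 2) R} (h : Lead n f g) (c : R) :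
    Lead n (c • f) (c • g) :=
  ⟨(totalDegree_smul_le _ _).trans h.1, by rw [map_smul, h.2]⟩

lemma Lead.X_mul {n : ℕ} {f g : MvPolynomial (Fin 2) R} (h : Lead n f g) (i : Fin 2) :
    Lead (n + 1) (X i * f) (X i * g) := by
  constructor
  · refine (totalDegree_mul _ _).trans ?_
    have : (X i : MvPolynomial (Fin 2) R).totalDegree ≤ 1 := by
      rw [X]
      exact (totalDegree_monomial_le _ _).trans (by simp)
    have := h.1
    omega
  · rw [← h.2]
    ext m
    rw [coeff_homogeneousComponent, coeff_X_mul', coeff_X_mul', coeff_homogeneousComponent]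
    by_cases hi : i ∈ m.support
    · simp only [hi, if_true]
      have : m = (m - Finsupp.single i 1) + Finsupp.single i 1 := by
        rw [tsub_add_cancel_of_le]
        rw [Finsupp.single_le_iff]
        have := Finsupp.mem_support_iff.1 hi
        omega
      have e : m.degree = (m - Finsupp.single i 1).degree + 1 := by
        conv_lhs => rw [this]
        simp [Finsupp.degree_single]
      simp only [e, Nat.add_right_cancel_iff]
    · simp [hi]

lemma totalDegree_le_iff' {f : MvPolynomial (Fin 2) R} {n : ℕ} :
    f.totalDegree ≤ n ↔ ∀ m, coeff m f ≠ 0 → m.degree ≤ n := by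
  constructor
  · intro h m hm
    exact (le_totalDegree (mem_support_iff.2 hm)).trans h
  · intro h
    exact Finset.sup_le fun m hm => h m (mem_support_iff.1 hm)

lemma totalDegree_pderiv_le (i : Fin 2) {n : ℕ} {f : MvPolynomial (Fin 2) R} (h : f.totalDegree ≤ n) :
    (pderiv i f).totalDegree ≤ n - 1 := by
  rw [totalDegree_le_iff'] at h ⊢
  intro m hm
  rw [coeff_pderiv] at hm
  have := h _ (left_ne_zero_of_mul hm)
  rw [map_add, Finsupp.degree_single] at this
  omega

lemma lead_gX {n : ℕ} {f g : MvPolynomial (Fin 2) R} (h : Lead n f g) :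
    Lead (n + 1) (rho R (gX R) f) (X 0 * g) := by
  rw [rho_gX]; exact h.X_mul 0

lemma lead_gY {n : ℕ} {f g : MvPolynomial (Fin 2) R} (h : Lead n f g) :
    Lead (n + 1) (rho R (gY R) f) (X 1 * g) := by
  rw [rho_gY]
  have h2 : Lead (n+1) (pderiv 0 f) 0 := lead_of_lt (by
    have := totalDegree_pderiv_le 0 h.1
    omega)
  simpa using h2.add (h.X_mul 1)

lemma lead_mon {n : ℕ} {f g : MvPolynomial (Fin 2) R} (h : Lead n f g) (i j : ℕ) :
    Lead (i + j + n) (rho R (gX R ^ i * gY R ^ j) f) (X 0 ^ i * X 1 ^ j * g) := by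
  induction i with
  | zero =>
    induction j with
    | zero => simpa using h
    | succ j ih =>
      have := lead_gY ih
      simp only [pow_zero, one_mul, zero_add] at this ⊢
      rw [pow_succ', map_mul, Module.End.mul_apply]
      convert this using 1
      · ring
      · ring
  | succ i ih =>
    have := lead_gX ih
    rw [pow_succ', mul_assoc, map_mul, Module.End.mul_apply]
    convert this using 1
    · ring
    · ring

lemma Lead.rho {m n : ℕ} {a : WeylAlgebra R} {f g g' : MvPolynomial (Fin 2) R}
    (ha : Lead m (sig R a) g) (h : Lead n f g') : Lead (m + n) (rho R a f) (g * g') := by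
  obtain ⟨q, rfl⟩ := tau_surj a
  rw [sig_tau] at ha
  obtain ⟨h1, rfl⟩ := ha
  have key : ∀ s : Finset (Fin 2 →₀ ℕ), (∀ d ∈ s, d.degree ≤ m) →
      Lead (m + n) (WA.rho R (tau R (∑ d ∈ s, monomial d (coeff d q))) f)
        (homogeneousComponent m (∑ d ∈ s, monomial d (coeff d q)) * g') := by
    intro s
    classical
    induction s using Finset.induction_on with
    | empty => 
      intro _
      simp only [Finset.sum_empty, map_zero, zero_mul, LinearMap.zero_apply]
      exact ⟨by simp, by simp⟩
    | insert d s hd ih =>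
      intro hs
      rw [Finset.sum_insert hd]
      simp only [map_add, LinearMap.add_apply, add_mul]
      refine Lead.add ?_ (ih fun e he => hs e (Finset.mem_insert_of_mem he))
      have hdm := hs d (Finset.mem_insert_self _ _)
      rw [tau_monomial, map_smul, LinearMap.smul_apply]
      have hl := lead_mon h (d 0) (d 1)
      have hdeg : d.degree = d 0 + d 1 := by
        simp [Finsupp.degree_eq_sum]
      have e1 : (monomial d (coeff d q) : MvPolynomial (Fin 2) R) = coeff d q • monomial d 1 := by
        simp [smul_monomial]
      rw [e1, map_smul, smul_mul_assoc]
      refine Lead.smul ?_ _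
      rcases hdm.lt_or_eq with hlt | heq
      · have : homogeneousComponent m (monomial d (1:R)) = 0 := by
          ext e
          rw [coeff_homogeneousComponent]
          split_ifs with he
          · rw [coeff_monomial, if_neg]
            · simp
            · rintro rfl; omega
          · simp
        rw [this, zero_mul]
        apply lead_of_lt
        have := hl.1
        rw [mon]
        omega
      · have : homogeneousComponent m (monomial d (1:R)) = monomial d 1 := by
          ext e
          rw [coeff_homogeneousComponent]
          split_ifs with he
          · rfl
          · rw [coeff_monomial, if_neg]
            rintro rfl; omega
        rw [this, monomial_eq', mon]
        rw [← heq, hdeg]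
        exact hl
  have := key q.support (fun d hd => totalDegree_le_iff'.1 h1 d (mem_support_iff.1 hd))
  rwa [support_sum_monomial_coeff] at this

end degree

section domain
variable {k : Type*} [CommRing k] [IsDomain k]

lemma hc_ne_zero {f : MvPolynomial (Fin 2) k} (h : f ≠ 0) :
    homogeneousComponent f.totalDegree f ≠ 0 := by
  intro h0
  obtain ⟨d, hd⟩ := ne_zero_iff.1 h
  have hle := totalDegree_le_iff'.1 (le_refl f.totalDegree)
  rcases Nat.eq_zero_or_pos f.totalDegree with hz | hp
  · have := congrArg (coeff d) h0
    rw [coeff_homogeneousComponent, if_pos, coeff_zero] at this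
    · exact hd this
    · have := hle d hd
      omega
  · have : f.totalDegree ≤ f.totalDegree - 1 := by
      rw [totalDegree_le_iff']
      intro m hm
      have h1 := hle m hm
      have h2 := congrArg (coeff m) h0
      rw [coeff_homogeneousComponent, coeff_zero] at h2
      have h3 : m.degree ≠ f.totalDegree := fun e => hm (by rwa [if_pos e] at h2)
      omega
    omega

lemma totalDegree_sig_mul {a b : WeylAlgebra k} (ha : a ≠ 0) (hb : b ≠ 0) :
    a * b ≠ 0 ∧ (sig k (a * b)).totalDegree = (sig k a).totalDegree + (sig k b).totalDegree := by
  have ha' : sig k a ≠ 0 := fun h => ha (sig_inj (by rw [h, map_zero]))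
  have hb' : sig k b ≠ 0 := fun h => hb (sig_inj (by rw [h, map_zero]))
  have h := Lead.rho (lead_self (sig k a) le_rfl) (lead_self (sig k b) le_rfl)
  rw [← sig_mul] at h
  have hne := mul_ne_zero (hc_ne_zero ha') (hc_ne_zero hb')
  rw [← h.2] at hne
  refine ⟨?_, le_antisymm h.1 ?_⟩
  · intro h0
    rw [h0] at hne
    simp at hne
  · by_contra hlt
    exact hne (homogeneousComponent_eq_zero _ _ (not_le.1 hlt))

instance : Nontrivial (WeylAlgebra k) := by
  refine ⟨⟨0, 1, fun h => ?_⟩⟩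
  have := congrArg (sig k) h
  rw [sig_one, map_zero] at this
  exact zero_ne_one this

instance : NoZeroDivisors (WeylAlgebra k) where
  eq_zero_or_eq_zero_of_mul_eq_zero := by
    intro a b h
    by_contra! hc
    exact (totalDegree_sig_mul hc.1 hc.2).1 h

instance : IsDomain (WeylAlgebra k) := NoZeroDivisors.to_isDomain _

lemma unit_const {a b : WeylAlgebra k} (h : a * b = 1) : ∃ c : k, a = algebraMap k _ c := by
  have ha : a ≠ 0 := by rintro rfl; simp at h
  have hb : b ≠ 0 := by rintro rfl; simp at h
  have := (totalDegree_sig_mul ha hb).2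
  rw [h, sig_one, totalDegree_one] at this
  have h0 : (sig k a).totalDegree = 0 := by omega
  rw [totalDegree_eq_zero_iff_eq_C] at h0
  refine ⟨coeff 0 (sig k a), sig_inj ?_⟩
  rw [sig_algebraMap]
  exact h0

end domain
end WA

namespace WA

section azumaya
variable {A : Type*} [Ring A]

lemma v_mul_pow {u v : A} (h : v * u = u * v + 1) (n : ℕ) :
    v * u ^ n = u ^ n * v + n • u ^ (n - 1) := by
  induction n with
  | zero => simp
  | succ n ih =>
    rw [pow_succ, ← mul_assoc, ih, add_mul, mul_assoc, h]
    rcases n with _ | n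
    · simp
    · simp only [Nat.add_sub_cancel, smul_mul_assoc, ← pow_succ]
      simp only [add_smul, one_smul, mul_add, mul_one, ← mul_assoc, ← pow_succ]
      abel

lemma comm_sum {u v : A} (h : v * u = u * v + 1) (n : ℕ) (c : ℕ → A) (hc : ∀ i, v * c i = c i * v) :
    v * (∑ i ∈ Finset.range (n + 1), u ^ i * c i) - (∑ i ∈ Finset.range (n + 1), u ^ i * c i) * v
      = ∑ i ∈ Finset.range n, u ^ i * ((i + 1) • c (i + 1)) := by
  rw [Finset.mul_sum, Finset.sum_mul, ← Finset.sum_sub_distrib, Finset.sum_range_succ']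
  have h0 : v * (u ^ 0 * c 0) - u ^ 0 * c 0 * v = 0 := by simp [hc]
  rw [h0, add_zero]
  refine Finset.sum_congr rfl fun i _ => ?_
  rw [← mul_assoc, v_mul_pow h, mul_assoc, ← hc, add_mul, mul_assoc, add_sub_cancel_left,
    Nat.add_sub_cancel, smul_mul_assoc, mul_smul_comm]

variable (p : ℕ) [Fact p.Prime] [Algebra (ZMod p) A]

lemma natinv {n : ℕ} (hn : n + 1 < p) (a : A) :
    ((n + 1 : ℕ) : ZMod p)⁻¹ • ((n + 1) • a) = a := by
  have h1 : ((n + 1 : ℕ) : ZMod p) ≠ 0 := by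
    rw [Ne, ZMod.natCast_eq_zero_iff]
    exact fun hd => absurd (Nat.le_of_dvd (Nat.succ_pos n) hd) (by omega)
  rw [← Nat.cast_smul_eq_nsmul (ZMod p), smul_smul, inv_mul_cancel₀ h1, one_smul]

lemma indep1 {u v : A} (h : v * u = u * v + 1) (n : ℕ) : n ≤ p → ∀ (c : ℕ → A),
    (∀ i, v * c i = c i * v) → ∑ i ∈ Finset.range n, u ^ i * c i = 0 → ∀ i < n, c i = 0 := by
  induction n with
  | zero => intro _ c _ _ i hi; omega
  | succ n ih =>
    intro hn c hc h0
    have h1 := comm_sum h n c hc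
    rw [h0, mul_zero, zero_mul, sub_zero] at h1
    have h2 := ih (by omega) (fun i => (i + 1) • c (i + 1))
      (fun i => by rw [mul_smul_comm, hc, smul_mul_assoc]) h1.symm
    have h3 : ∀ i < n, c (i + 1) = 0 := by
      intro i hi
      rw [← natinv p (by omega : i + 1 < p) (c (i + 1)), h2 i hi, smul_zero]
    rw [Finset.sum_range_succ', Finset.sum_eq_zero] at h0
    · intro i hi
      rcases i with _ | i
      · simpa using h0
      · exact h3 i (by omega)
    · intro i hi
      rw [h3 i (Finset.mem_range.1 hi), mul_zero]

lemma decomp1 [NoZeroDivisors A] {u v : A} (h : v * u = u * v + 1) {z : A} (hz : z ≠ 0)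
    (hzc : ∀ b, z * b = b * z) (n : ℕ) : n ≤ p → ∀ (a : A) (c : ℕ → A),
    (∀ i, v * c i = c i * v) → z * a = ∑ i ∈ Finset.range n, u ^ i * c i →
    ∃ c' : ℕ → A, (∀ i < n, z * c' i = c i) ∧ a = ∑ i ∈ Finset.range n, u ^ i * c' i := by
  induction n with
  | zero =>
    intro _ a c _ h0
    refine ⟨0, by simp, ?_⟩
    simpa [hz] using h0
  | succ n ih =>
    intro hn a c hc h0
    have h1 := comm_sum h n c hc
    rw [← h0, ← mul_assoc, ← hzc, mul_assoc, mul_assoc, ← mul_sub] at h1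
    obtain ⟨d, hd, hb⟩ := ih (by omega) _ (fun i => (i + 1) • c (i + 1))
      (fun i => by rw [mul_smul_comm, hc, smul_mul_assoc]) h1
    let e : ℕ → A := fun i => ((i + 1 : ℕ) : ZMod p)⁻¹ • d i
    have he : ∀ i < n, z * e i = c (i + 1) := by
      intro i hi
      simp only [e]
      rw [mul_smul_comm, hd i hi, natinv p (by omega)]
    let s := ∑ i ∈ Finset.range n, u ^ (i + 1) * e i
    refine ⟨fun i => Nat.casesOn i (a - s) e, ?_, ?_⟩
    · intro i hi
      rcases i with _ | i
      · show z * (a - s) = c 0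
        rw [mul_sub, h0, Finset.sum_range_succ', Finset.mul_sum, pow_zero, one_mul]
        rw [sub_eq_iff_eq_add, add_comm]
        congr 1
        refine Finset.sum_congr rfl fun i hi => ?_
        rw [← mul_assoc, hzc, mul_assoc, he i (Finset.mem_range.1 hi)]
      · exact he i (by omega)
    · rw [Finset.sum_range_succ']
      simp [s]

/-- centrality as a plain predicate -/
def Cen (z : A) : Prop := ∀ b : A, z * b = b * z

lemma pchar (a : A) : p • a = 0 := by
  rw [← Nat.cast_smul_eq_nsmul (ZMod p)]; simp

lemma commute_pow_p {u v : A} (h : v * u = u * v + 1) : v * u ^ p = u ^ p * v := by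
  rw [v_mul_pow h, pchar p, add_zero]

lemma swap_rel {x y : A} (h : y * x = x * y + 1) : (-x) * y = y * (-x) + 1 := by
  rw [mul_neg, h]; simp

lemma indep2 {x y : A} (h : y * x = x * y + 1) (c : ℕ → ℕ → A) (hc : ∀ i j, Cen (c i j))
    (h0 : ∑ i ∈ Finset.range p, x ^ i * ∑ j ∈ Finset.range p, y ^ j * c i j = 0) :
    ∀ i < p, ∀ j < p, c i j = 0 := by
  intro i hi
  have h1 := indep1 p h p le_rfl (fun i => ∑ j ∈ Finset.range p, y ^ j * c i j) (fun i => by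
    rw [Finset.mul_sum, Finset.sum_mul]
    refine Finset.sum_congr rfl fun j _ => ?_
    rw [mul_assoc, hc, ← mul_assoc, ← mul_assoc, ← pow_succ, ← pow_succ']) h0 i hi
  exact indep1 p (swap_rel h) p le_rfl (fun j => c i j) (fun j => (hc i j _).symm) h1

lemma decomp2 [NoZeroDivisors A] {x y : A} (h : y * x = x * y + 1) {z : A} (hz : z ≠ 0)
    (hzc : Cen z) (a : A) (c : ℕ → ℕ → A) (hc : ∀ i j, Cen (c i j))
    (h0 : z * a = ∑ i ∈ Finset.range p, x ^ i * ∑ j ∈ Finset.range p, y ^ j * c i j) :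
    ∃ c' : ℕ → ℕ → A, (∀ i < p, ∀ j < p, Cen (c' i j)) ∧
      a = ∑ i ∈ Finset.range p, x ^ i * ∑ j ∈ Finset.range p, y ^ j * c' i j := by
  obtain ⟨d, hd, ha⟩ := decomp1 p h hz hzc p le_rfl a (fun i => ∑ j ∈ Finset.range p, y ^ j * c i j)
    (fun i => by
      rw [Finset.mul_sum, Finset.sum_mul]
      refine Finset.sum_congr rfl fun j _ => ?_
      rw [mul_assoc, hc, ← mul_assoc, ← mul_assoc, ← pow_succ, ← pow_succ']) h0
  have h2 : ∀ i, ∃ e : ℕ → A, i < p → (∀ j < p, z * e j = c i j) ∧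
      d i = ∑ j ∈ Finset.range p, y ^ j * e j := by
    intro i
    by_cases hi : i < p
    · obtain ⟨e, he⟩ := decomp1 p (swap_rel h) hz hzc p le_rfl (d i) (fun j => c i j)
        (fun j => (hc i j _).symm) (hd i hi)
      exact ⟨e, fun _ => he⟩
    · exact ⟨0, fun h => absurd h hi⟩
  choose e he using h2
  refine ⟨e, ?_, ?_⟩
  · intro i hi j hj b
    have h3 := (he i hi).1 j hj
    have h4 := hc i j b
    rw [← h3, mul_assoc, ← mul_assoc b, ← hzc b, mul_assoc] at h4
    exact mul_left_cancel₀ hz h4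
  · rw [ha]
    refine Finset.sum_congr rfl fun i hi => ?_
    rw [← (he i (Finset.mem_range.1 hi)).2]

lemma cen_iff {z : A} : Cen z ↔ z ∈ Subalgebra.center (ZMod p) A := by
  rw [Subalgebra.mem_center_iff]
  exact ⟨fun h b => (h b).symm, fun h b => (h b).symm⟩

/-- extension by zero of a square array -/
noncomputable def extc (c : Fin p × Fin p → Subalgebra.center (ZMod p) A) (i j : ℕ) : A :=
  if hi : i < p then if hj : j < p then (c (⟨i, hi⟩, ⟨j, hj⟩) : A) else 0 else 0

lemma extc_fin (c : Fin p × Fin p → Subalgebra.center (ZMod p) A) (i j : Fin p) :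
    extc p c i j = c (i, j) := by
  simp [extc]

lemma extc_cen (c : Fin p × Fin p → Subalgebra.center (ZMod p) A) (i j : ℕ) :
    Cen (extc p c i j) := by
  unfold extc
  split_ifs
  · exact (cen_iff p).2 (c _).2
  all_goals intro b; simp

lemma extc_sum {x y : A} (c : Fin p × Fin p → Subalgebra.center (ZMod p) A) :
    ∑ q, c q • (x ^ (q.1 : ℕ) * y ^ (q.2 : ℕ)) =
      ∑ i ∈ Finset.range p, x ^ i * ∑ j ∈ Finset.range p, y ^ j * extc p c i j := by
  rw [Fintype.sum_prod_type, Finset.sum_range]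
  refine Finset.sum_congr rfl fun i _ => ?_
  rw [Finset.sum_range, Finset.mul_sum]
  refine Finset.sum_congr rfl fun j _ => ?_
  rw [extc_fin]
  have hcen := (cen_iff p).2 (c (i, j)).2
  rw [← mul_assoc, ← hcen]
  rfl

lemma azu [IsDomain A] (w : Fin p × Fin p → A)
    (hw : Submodule.span (Subalgebra.center (ZMod p) A) (Set.range w) = ⊤)
    {x y : A} (h : y * x = x * y + 1) (a : A) :
    ∃ c : ℕ → ℕ → A, (∀ i < p, ∀ j < p, Cen (c i j)) ∧
      a = ∑ i ∈ Finset.range p, x ^ i * ∑ j ∈ Finset.range p, y ^ j * c i j := by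
  classical
  let f : Option (Fin p × Fin p) → A := fun o => o.elim a (fun q => x ^ (q.1 : ℕ) * y ^ (q.2 : ℕ))
  have hli : ¬ LinearIndependent (Subalgebra.center (ZMod p) A) f := by
    intro hli
    have := linearIndependent_le_span f hli (Set.range w) hw
    have h1 : Fintype.card (Set.range w) ≤ p * p := by
      refine (Fintype.card_range_le w).trans ?_
      simp
    rw [Cardinal.mk_fintype, Nat.cast_le] at this
    simp at this
    simp at h1
    omega
  rw [Fintype.not_linearIndependent_iff] at hli
  obtain ⟨g, hg, hne⟩ := hli
  rw [Fintype.sum_option] at hg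
  by_cases hz : g none = 0
  · exfalso
    simp only [f, hz, zero_smul, zero_add, Option.elim] at hg
    rw [extc_sum p (fun q => g (some q))] at hg
    have := indep2 p h (extc p (fun q => g (some q))) (extc_cen p _) hg
    obtain ⟨o, ho⟩ := hne
    rcases o with _ | ⟨i, j⟩
    · exact ho hz
    · have h3 := this i i.2 j j.2
      rw [extc_fin] at h3
      exact ho (Subtype.ext h3)
  · have hz' : (g none : A) ≠ 0 := fun h => hz (Subtype.ext h)
    have e1 : (g none : A) * a = ∑ q, (-g (some q)) • (x ^ (q.1 : ℕ) * y ^ (q.2 : ℕ)) := by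
      simp only [neg_smul, Finset.sum_neg_distrib]
      exact eq_neg_of_add_eq_zero_left hg
    rw [extc_sum p (fun q => -g (some q))] at e1
    exact decomp2 p h hz' ((cen_iff p).2 (g none).2) a (extc p (fun q => -g (some q))) (extc_cen p _) e1

lemma azu_pow_cen [IsDomain A] (w : Fin p × Fin p → A)
    (hw : Submodule.span (Subalgebra.center (ZMod p) A) (Set.range w) = ⊤)
    {x y : A} (h : y * x = x * y + 1) : Cen (x ^ p) ∧ Cen (y ^ p) := by
  have key : ∀ t : A, t * x = x * t → t * y = y * t → Cen t := by
    intro t hx hy a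
    obtain ⟨c, hc, rfl⟩ := azu p w hw h a
    have hx' : Commute t x := hx
    have hy' : Commute t y := hy
    refine Commute.sum_right _ _ _ fun i hi => (hx'.pow_right i).mul_right ?_
    refine Commute.sum_right _ _ _ fun j hj => (hy'.pow_right j).mul_right ?_
    exact (hc i (Finset.mem_range.1 hi) j (Finset.mem_range.1 hj) t).symm
  refine ⟨key _ (((Commute.refl x).pow_left p)) (commute_pow_p p h).symm,
    key _ ?_ ((Commute.refl y).pow_left p)⟩
  have := commute_pow_p p (swap_rel h)
  simpa using this.symm

end azumaya
end WA

namespace WA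

section deriv
variable {W A : Type*} [Ring W] [Ring A] (p : ℕ) [Fact p.Prime] [Algebra (ZMod p) A]

lemma exists_deriv (π : W →+* A) (hsurj : Function.Surjective π)
    (hker : ∀ w, π w = 0 → ∃ v, w = (p : W) * v) (hnzd : ∀ w : W, (p : W) * w = 0 → w = 0)
    (g : W) (hg : Cen (π g)) :
    ∃ D : Derivation ℤ (Subalgebra.center (ZMod p) A) (Subalgebra.center (ZMod p) A),
      ∀ (z : Subalgebra.center (ZMod p) A) (w v : W), π w = z → g * w - w * g = (p : W) * v →
        (D z : A) = π v := by
  have hpc : ∀ w : W, w * (p : W) = (p : W) * w := fun w => (Nat.cast_commute p w).eq.symm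
  have uniq : ∀ w1 w2 v1 v2 : W, π w1 = π w2 → g * w1 - w1 * g = (p : W) * v1 →
      g * w2 - w2 * g = (p : W) * v2 → π v1 = π v2 := by
    intro w1 w2 v1 v2 h h1 h2
    obtain ⟨u, hu⟩ := hker (w1 - w2) (by rw [map_sub, h, sub_self])
    have e : (p : W) * (v1 - v2 - (g * u - u * g)) = 0 := by
      rw [mul_sub, mul_sub, ← h1, ← h2, mul_sub, ← mul_assoc, ← hpc g, ← mul_assoc, mul_assoc, ← hu]
      noncomm_ring
    have e2 := congrArg π (hnzd _ e)
    rw [map_zero, map_sub, map_sub, map_sub, map_mul, map_mul, hg, sub_self, sub_zero] at e2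
    exact sub_eq_zero.1 e2
  have ex : ∀ z : Subalgebra.center (ZMod p) A, ∃ c : Subalgebra.center (ZMod p) A, ∃ w v : W,
      π w = z ∧ g * w - w * g = (p : W) * v ∧ (c : A) = π v := by
    intro z
    obtain ⟨w, hw⟩ := hsurj z
    have hz : Cen (z : A) := (cen_iff p).2 z.2
    obtain ⟨v, hv⟩ := hker (g * w - w * g) (by rw [map_sub, map_mul, map_mul, hg, sub_self])
    have hc : Cen (π v) := by
      intro b
      obtain ⟨t, rfl⟩ := hsurj b
      obtain ⟨s, hs⟩ := hker (w * t - t * w) (by rw [map_sub, map_mul, map_mul, hw, hz, sub_self])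
      obtain ⟨r, hr⟩ := hker (g * t - t * g) (by rw [map_sub, map_mul, map_mul, hg, sub_self])
      have e : (p : W) * ((v * t - t * v) - ((g * s - s * g) - (w * r - r * w))) = 0 := by
        have e1 : (p : W) * (v * t - t * v) = (g * w - w * g) * t - t * (g * w - w * g) := by
          rw [hv, mul_sub, ← mul_assoc, ← mul_assoc, ← mul_assoc, hpc]
        have e2 : (p : W) * (g * s - s * g) = g * (w * t - t * w) - (w * t - t * w) * g := by
          rw [hs, mul_sub, ← mul_assoc, ← mul_assoc, ← mul_assoc, hpc]
        have e3 : (p : W) * (w * r - r * w) = w * (g * t - t * g) - (g * t - t * g) * w := by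
          rw [hr, mul_sub, ← mul_assoc, ← mul_assoc, ← mul_assoc, hpc]
        rw [mul_sub, mul_sub (p : W) (g * s - s * g), e1, e2, e3]
        noncomm_ring
      have e2 := congrArg π (hnzd _ e)
      simp only [map_sub, map_mul, map_zero] at e2
      rw [hg, hw, hz (π r), sub_self, sub_self, sub_self, sub_zero] at e2
      exact sub_eq_zero.1 e2
    exact ⟨⟨π v, (cen_iff p).1 hc⟩, w, v, hw, hv, rfl⟩
  choose d w v h1 h2 h3 using ex
  have key : ∀ (z : Subalgebra.center (ZMod p) A) (w' v' : W), π w' = z →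
      g * w' - w' * g = (p : W) * v' → (d z : A) = π v' := by
    intro z w' v' hw hv
    rw [h3]
    exact uniq _ _ _ _ ((h1 z).trans hw.symm) (h2 z) hv
  have hadd : ∀ a b, d (a + b) = d a + d b := by
    intro a b
    apply Subtype.ext
    rw [key (a + b) (w a + w b) (v a + v b)]
    · rw [map_add, ← h3, ← h3]; rfl
    · rw [map_add, h1, h1]; rfl
    · rw [mul_add (p : W), ← h2, ← h2]; noncomm_ring
  let D0 : (Subalgebra.center (ZMod p) A) →+ (Subalgebra.center (ZMod p) A) := AddMonoidHom.mk' d hadd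
  refine ⟨Derivation.mk' D0.toIntLinearMap ?_, ?_⟩
  · intro a b
    show d (a * b) = a * d b + b * d a
    apply Subtype.ext
    rw [key (a * b) (w a * w b) (v a * w b + w a * v b)]
    · have hb : Cen (b : A) := (cen_iff p).2 b.2
      rw [map_add, map_mul, map_mul, ← h3, ← h3, h1, h1, ← hb, add_comm]; rfl
    · rw [map_mul, h1, h1]; rfl
    · have e1 : (p : W) * (v a * w b) = (g * w a - w a * g) * w b := by rw [h2, mul_assoc]
      have e2 : (p : W) * (w a * v b) = w a * (g * w b - w b * g) := by
        rw [h2, ← mul_assoc, ← hpc, mul_assoc]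
      rw [mul_add (p : W), e1, e2]; noncomm_ring
  · exact key

lemma pow_comm {x y : W} (h : y * x = x * y + 1) (n : ℕ) :
    y ^ n * x ^ n = ∑ k ∈ Finset.range (n + 1), (n.choose k * n.descFactorial k) • (x ^ (n - k) * y ^ (n - k)) := by
  let ad : Module.End ℤ W := LinearMap.mulLeft ℤ y - LinearMap.mulRight ℤ y
  have had : ∀ k, (ad ^ k) (x ^ n) = (n.descFactorial k) • x ^ (n - k) := by
    intro k
    induction k with
    | zero => simp
    | succ k ih =>
      rw [pow_succ', Module.End.mul_apply, ih, map_nsmul]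
      simp only [ad, LinearMap.sub_apply, LinearMap.mulLeft_apply, LinearMap.mulRight_apply]
      rw [v_mul_pow h, add_sub_cancel_left, smul_smul, Nat.descFactorial_succ, mul_comm, Nat.sub_sub]
  have hcomm : Commute ad (LinearMap.mulRight ℤ y) := by
    refine Commute.sub_left ?_ (Commute.refl _)
    exact LinearMap.commute_mulLeft_right (R := ℤ) y y
  have e : LinearMap.mulLeft ℤ y = LinearMap.mulRight ℤ y + ad := by simp [ad]
  have e2 : y ^ n * x ^ n = ((LinearMap.mulLeft ℤ y) ^ n) (x ^ n) := by
    rw [LinearMap.pow_mulLeft]; rfl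
  rw [e2, e, add_comm, hcomm.add_pow, LinearMap.sum_apply]
  refine Finset.sum_congr rfl fun k _ => ?_
  rw [hcomm.pow_pow k (n - k) |>.eq, ← Nat.cast_comm, ← nsmul_eq_mul, LinearMap.smul_apply, Module.End.mul_apply, had, map_nsmul, LinearMap.pow_mulRight, LinearMap.mulRight_apply, smul_smul]

lemma pow_p_comm {x y : W} (h : y * x = x * y + 1) :
    ∃ S : W, y ^ p * x ^ p - x ^ p * y ^ p = (p : W) * (((p - 1).factorial : W) + (p : W) * S) := by
  have hp : p.Prime := Fact.out
  have hS : ∃ S : W, ∑ k ∈ Finset.range (p - 1), (p.choose (k + 1) * p.descFactorial (k + 1)) •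
      (x ^ (p - (k + 1)) * y ^ (p - (k + 1))) = (p : W) * ((p : W) * S) := by
    have hk : ∀ k, k ∈ Finset.range (p - 1) → ∃ m, p.choose (k + 1) * p.descFactorial (k + 1) = p * (p * m) := by
      intro k hk
      rw [Finset.mem_range] at hk
      obtain ⟨a, ha⟩ := hp.dvd_choose_self (k := k + 1) (by omega) (by omega)
      obtain ⟨q, rfl⟩ : ∃ q, p = q + 1 := ⟨p - 1, by omega⟩
      exact ⟨a * q.descFactorial k, by rw [ha, Nat.succ_descFactorial_succ]; ring⟩
    choose! m hm using hk
    refine ⟨∑ k ∈ Finset.range (p - 1), m k • (x ^ (p - (k + 1)) * y ^ (p - (k + 1))), ?_⟩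
    rw [Finset.mul_sum, Finset.mul_sum]
    refine Finset.sum_congr rfl fun k hk => ?_
    rw [hm k hk]
    simp only [nsmul_eq_mul, Nat.cast_mul, mul_assoc]
  obtain ⟨S, hS⟩ := hS
  refine ⟨S, ?_⟩
  rw [pow_comm h, Finset.sum_range_succ]
  obtain ⟨q, hq⟩ : ∃ q, p = q + 1 := ⟨p - 1, by have := hp.pos; omega⟩
  have e : Finset.range p = Finset.range (p - 1 + 1) := by rw [hq]; simp
  rw [e, Finset.sum_range_succ', hS, mul_add]
  have e3 : (p : W) * ((p - 1).factorial : W) = (p.factorial : W) := by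
    rw [← Nat.cast_mul, Nat.mul_factorial_pred hp.ne_zero]
  rw [e3]
  simp [Nat.descFactorial_self]
  abel

variable {p} in
lemma factA : (((p - 1).factorial : ℕ) : A) = -1 := by
  have h := ZMod.wilsons_lemma p
  have := congrArg (algebraMap (ZMod p) A) h
  rw [map_natCast, map_neg, map_one] at this
  exact this

lemma p_zero : (p : A) = 0 := by
  have := pchar p (1 : A)
  simpa using this

/-- the two derivations -/
lemma exists_D12 (π : W →+* A) (hsurj : Function.Surjective π)
    (hker : ∀ w, π w = 0 → ∃ v, w = (p : W) * v) (hnzd : ∀ w : W, (p : W) * w = 0 → w = 0)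
    {x y : W} (h : y * x = x * y + 1) (xp yp : Subalgebra.center (ZMod p) A)
    (hx : (xp : A) = π x ^ p) (hy : (yp : A) = π y ^ p) :
    ∃ D1 D2 : Derivation ℤ (Subalgebra.center (ZMod p) A) (Subalgebra.center (ZMod p) A),
      D1 xp = 1 ∧ D1 yp = 0 ∧ D2 xp = 0 ∧ D2 yp = 1 := by
  obtain ⟨E1, hE1⟩ := exists_deriv p π hsurj hker hnzd (y ^ p) (by
    rw [map_pow, ← hy]; exact (cen_iff p).2 yp.2)
  obtain ⟨E2, hE2⟩ := exists_deriv p π hsurj hker hnzd (x ^ p) (by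
    rw [map_pow, ← hx]; exact (cen_iff p).2 xp.2)
  obtain ⟨S, hS⟩ := pow_p_comm p h
  refine ⟨-E1, E2, ?_, ?_, ?_, ?_⟩
  · apply Subtype.ext
    have := hE1 xp (x ^ p) _ (by rw [map_pow, hx]) hS
    rw [Derivation.neg_apply]
    push_cast
    rw [this]
    simp [p_zero p, factA]
  · apply Subtype.ext
    have := hE1 yp (y ^ p) 0 (by rw [map_pow, hy]) (by simp)
    rw [Derivation.neg_apply]
    push_cast
    rw [this]
    simp
  · apply Subtype.ext
    have := hE2 xp (x ^ p) 0 (by rw [map_pow, hx]) (by simp)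
    rw [this]
    simp
  · apply Subtype.ext
    have := hE2 yp (y ^ p) (-(((p - 1).factorial : W) + (p : W) * S)) (by rw [map_pow, hy]) (by
      rw [mul_neg, ← hS, neg_sub])
    rw [this]
    simp [p_zero p, factA]

end deriv
end WA

namespace WA
set_option linter.unusedSectionVars false
set_option linter.unusedSimpArgs false
open MvPolynomial

section comm
variable (p : ℕ) [Fact p.Prime]

lemma exists_expand (F : MvPolynomial (Fin 2) (ZMod p)) (h : ∀ i, pderiv i F = 0) :
    ∃ G, F = expand p G := by
  have hd : ∀ m ∈ F.support, ∀ i, p ∣ m i := by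
    intro m hm i
    by_contra hn
    have hi : m i ≠ 0 := fun h0 => hn (by rw [h0]; exact dvd_zero p)
    have := coeff_pderiv (i := i) F (m - Finsupp.single i 1)
    rw [h i, coeff_zero] at this
    have e : m - Finsupp.single i 1 + Finsupp.single i 1 = m := by
      apply tsub_add_cancel_of_le
      rw [Finsupp.single_le_iff]; omega
    rw [e] at this
    have e2 : (((m - Finsupp.single i 1 : Fin 2 →₀ ℕ) i : ℕ) : ZMod p) + 1 = ((m i : ℕ) : ZMod p) := by
      rw [← Nat.cast_succ]; congr 1
      simp; omega
    rw [e2, eq_comm, mul_eq_zero, ZMod.natCast_eq_zero_iff] at this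
    rcases this with h1 | h1
    · exact (mem_support_iff.1 hm) h1
    · exact hn h1
  refine ⟨∑ m ∈ F.support, monomial (m.mapRange (· / p) (by simp)) (coeff m F), ?_⟩
  rw [map_sum]
  conv_lhs => rw [F.as_sum]
  refine Finset.sum_congr rfl fun m hm => ?_
  rw [expand_monomial]
  have e : p • m.mapRange (· / p) (by simp) = m := by
    ext i
    simp [Nat.mul_div_cancel' (hd m hm i)]
  rw [e]

variable {Z : Type*} [CommRing Z] [IsDomain Z] [Algebra (ZMod p) Z]
  (j : MvPolynomial (Fin 2) (ZMod p) →ₐ[ZMod p] Z) (D : Fin 2 → Derivation ℤ Z Z)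

lemma D_const {E : Derivation ℤ Z Z} (c : ZMod p) : E (algebraMap (ZMod p) Z c) = 0 := by
  have : algebraMap (ZMod p) Z c = ((c.val : ℕ) : Z) := by
    conv_lhs => rw [← ZMod.natCast_zmod_val c]
    rw [map_natCast]
  rw [this, Derivation.map_natCast]

lemma D_j (hD : ∀ i k, D i (j (X k)) = if i = k then 1 else 0) (i : Fin 2) (F : MvPolynomial (Fin 2) (ZMod p)) : D i (j F) = j (pderiv i F) := by
  induction F using MvPolynomial.induction_on with
  | C c => rw [pderiv_C, map_zero, ← MvPolynomial.algebraMap_eq, AlgHom.commutes, D_const]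
  | add f g hf hg => simp only [map_add, hf, hg]
  | mul_X f k hf =>
    rw [map_mul, Derivation.leibniz, hf, hD, Derivation.leibniz, pderiv_X]
    simp only [smul_eq_mul, map_add, map_mul]
    congr 2
    by_cases hik : i = k
    · subst hik; simp
    · simp [hik, Pi.single_apply, Ne.symm hik]

lemma j_inj (hD : ∀ i k, D i (j (X k)) = if i = k then 1 else 0) : Function.Injective j := by
  rw [injective_iff_map_eq_zero]
  have key : ∀ n : ℕ, ∀ F, F.totalDegree = n → j F = 0 → F = 0 := by
    intro n
    induction n using Nat.strong_induction_on with
    | _ n ih =>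
      intro F hn hF
      by_cases h0 : n = 0
      · subst h0
        rw [totalDegree_eq_zero_iff_eq_C] at hn
        rw [hn, ← MvPolynomial.algebraMap_eq, AlgHom.commutes] at hF
        rw [hn, (map_eq_zero _).1 hF, map_zero]
      have hp : ∀ i, pderiv i F = 0 := by
        intro i
        by_contra hne
        have hlt : (pderiv i F).totalDegree < n := by
          by_contra hge
          have h1 := totalDegree_pderiv_le i hn.le
          rcases Nat.lt_or_ge (pderiv i F).totalDegree n with h2 | h2
          · exact hge h2
          · omega
        refine hne (ih _ hlt _ rfl ?_)
        rw [← D_j p j D hD, hF, map_zero]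
      obtain ⟨G, rfl⟩ := exists_expand p F hp
      have hG : j G = 0 := by
        rw [expand_zmod, map_pow] at hF
        exact pow_eq_zero_iff (Fact.out : p.Prime).ne_zero |>.1 hF
      rw [totalDegree_expand] at hn
      have h2 := (Fact.out : p.Prime).two_le
      rw [ih G.totalDegree (by nlinarith [Nat.pos_of_ne_zero (fun h => h0 (by rw [← hn, h, zero_mul]) : G.totalDegree ≠ 0)]) G rfl hG, map_zero]
  exact fun F hF => key _ F rfl hF

lemma max_of_lt {π : MvPolynomial (Fin 2) (ZMod p)} (hπ : Prime π)
    (q : Ideal (MvPolynomial (Fin 2) (ZMod p))) [hq : q.IsPrime] (h : Ideal.span {π} < q) :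
    q.IsMaximal := by
  obtain ⟨M, hM, hle⟩ := Ideal.exists_le_maximal q hq.ne_top
  rcases hle.lt_or_eq with hlt | heq
  · exfalso
    have := hM.isPrime
    have : (Ideal.span {π}).IsPrime := (Ideal.span_singleton_prime hπ.ne_zero).2 hπ
    have : (⊥ : Ideal (MvPolynomial (Fin 2) (ZMod p))).IsPrime := Ideal.isPrime_bot
    have h0 : (⊥ : Ideal (MvPolynomial (Fin 2) (ZMod p))) < Ideal.span {π} := by
      rw [bot_lt_iff_ne_bot, Ne, Ideal.span_singleton_eq_bot]; exact hπ.ne_zero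
    have a1 := Ideal.height_add_one_le_of_lt_of_isPrime h0
    have a2 := Ideal.height_add_one_le_of_lt_of_isPrime h
    have a3 := Ideal.height_add_one_le_of_lt_of_isPrime hlt
    have a4 := Ideal.height_le_ringKrullDim_of_ne_top hM.ne_top
    rw [MvPolynomial.ringKrullDim_of_isNoetherianRing] at a4
    simp at a4
    have a5 : M.height ≤ 2 := WithBot.coe_le_coe.1 a4
    have a6 : (3 : ℕ∞) ≤ M.height := by
      refine le_trans ?_ a3
      refine le_trans ?_ (add_le_add_left a2 1)
      refine le_trans ?_ (add_le_add_left (add_le_add_left a1 1) 1)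
      calc (3 : ℕ∞) = 0 + 1 + 1 + 1 := by norm_num
        _ ≤ _ := by gcongr; exact zero_le
    have := a6.trans a5
    exact absurd this (by decide)
  · rw [heq]; exact hM

lemma sep_elem (q : Ideal (MvPolynomial (Fin 2) (ZMod p))) [hq : q.IsMaximal] (k : Fin 2) :
    ∃ f g : MvPolynomial (Fin 2) (ZMod p), f ∈ q ∧ g ∉ q ∧
      ∀ i, pderiv i f = if i = k then g else 0 := by
  let _ : Field (MvPolynomial (Fin 2) (ZMod p) ⧸ q) := Ideal.Quotient.field q
  have : Module.Finite (ZMod p) (MvPolynomial (Fin 2) (ZMod p) ⧸ q) :=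
    finite_of_finite_type_of_isJacobsonRing _ _
  let ξ : MvPolynomial (Fin 2) (ZMod p) ⧸ q := Ideal.Quotient.mkₐ (ZMod p) q (X k)
  let r := minpoly (ZMod p) ξ
  have hr : r.Separable := Algebra.IsSeparable.isSeparable (ZMod p) ξ
  have h0 : Polynomial.aeval ξ r = 0 := minpoly.aeval _ _
  have h1 := hr.aeval_derivative_ne_zero h0
  refine ⟨Polynomial.aeval (X k) r, Polynomial.aeval (X k) r.derivative, ?_, ?_, ?_⟩
  · rw [← Ideal.Quotient.eq_zero_iff_mem, ← Ideal.Quotient.mkₐ_eq_mk (ZMod p), ← Polynomial.aeval_algHom_apply]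
    exact h0
  · rw [← Ideal.Quotient.eq_zero_iff_mem, ← Ideal.Quotient.mkₐ_eq_mk (ZMod p), ← Polynomial.aeval_algHom_apply]
    exact h1
  · intro i
    rw [Derivation.map_aeval, pderiv_X]
    by_cases hik : i = k
    · subst hik; simp
    · simp [hik, Ne.symm hik]

lemma prime_step (hD : ∀ i k, D i (j (X k)) = if i = k then 1 else 0)
    [UniqueFactorizationMonoid Z] (hu : ∀ u : Z, IsUnit u → ∃ c : ZMod p, u = algebraMap _ _ c)
    {π b : MvPolynomial (Fin 2) (ZMod p)} (hπ : Prime π) (c : Z) (h : j π * c = j b) : π ∣ b := by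
  by_contra hn
  have hji := j_inj p j D hD
  have hnu : ¬ IsUnit (j π) := by
    intro hh
    obtain ⟨t, ht⟩ := hu _ hh
    rw [← j.commutes] at ht
    have := hji ht
    rw [this] at hπ
    have ht0 : t ≠ 0 := by rintro rfl; exact hπ.ne_zero (map_zero _)
    exact hπ.not_isUnit ((isUnit_iff_ne_zero.2 ht0).map _)
  have hne : j π ≠ 0 := fun h0 => hπ.ne_zero (hji (h0.trans (map_zero j).symm))
  obtain ⟨e, he, hdvd⟩ := WfDvdMonoid.exists_irreducible_factor hnu hne
  have hep : Prime e := UniqueFactorizationMonoid.irreducible_iff_prime.1 he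
  have hsp : (Ideal.span {e}).IsPrime := (Ideal.span_singleton_prime hep.ne_zero).2 hep
  let q := (Ideal.span {e}).comap j
  have hq : ∀ f, f ∈ q ↔ e ∣ j f := fun f => by
    rw [Ideal.mem_comap, Ideal.mem_span_singleton]
  have hqp : q.IsPrime := Ideal.comap_isPrime j _
  have hlt : Ideal.span {π} < q := by
    refine lt_of_le_of_ne ?_ ?_
    · rw [Ideal.span_singleton_le_iff_mem, hq]; exact hdvd
    · intro heq
      have : b ∈ q := by rw [hq, ← h]; exact hdvd.mul_right c
      rw [← heq, Ideal.mem_span_singleton] at this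
      exact hn this
  have hmax := max_of_lt p hπ q hlt
  obtain ⟨f0, g0, hf0, hg0, hd0⟩ := sep_elem p q 0
  obtain ⟨f1, g1, hf1, hg1, hd1⟩ := sep_elem p q 1
  rw [hq] at hf0 hf1 hg0 hg1
  obtain ⟨u, hu'⟩ := hf0
  obtain ⟨v, hv⟩ := hf1
  have a1 : e * D 1 u + u * D 1 e = 0 := by
    have := D_j p j D hD 1 f0
    rw [hu', Derivation.leibniz, hd0] at this
    simpa using this
  have a0 : e * D 0 u + u * D 0 e = j g0 := by
    have := D_j p j D hD 0 f0
    rw [hu', Derivation.leibniz, hd0] at this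
    simpa using this
  have b1 : e * D 1 v + v * D 1 e = j g1 := by
    have := D_j p j D hD 1 f1
    rw [hv, Derivation.leibniz, hd1] at this
    simpa using this
  have c1 : e ∣ u * D 1 e := ⟨-D 1 u, by linear_combination a1⟩
  rcases hep.dvd_or_dvd c1 with h2 | h2
  · exact hg0 (by rw [← a0]; exact dvd_add (dvd_mul_right _ _) (h2.mul_right _))
  · exact hg1 (by rw [← b1]; exact dvd_add (dvd_mul_right _ _) (h2.mul_left _))

lemma comm_main (hD : ∀ i k, D i (j (X k)) = if i = k then 1 else 0)
    [UniqueFactorizationMonoid Z] (hu : ∀ u : Z, IsUnit u → ∃ c : ZMod p, u = algebraMap _ _ c)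
    (θ : MvPolynomial (Fin 2) (ZMod p)) : θ ≠ 0 → ∀ (b : MvPolynomial (Fin 2) (ZMod p)) (c : Z),
    j θ * c = j b → ∃ c', c = j c' := by
  have hji := j_inj p j D hD
  induction θ using UniqueFactorizationMonoid.induction_on_prime with
  | h₁ => exact fun h => absurd rfl h
  | h₂ x hx =>
    intro _ b c h
    obtain ⟨y, hy⟩ := hx.exists_left_inv
    refine ⟨y * b, ?_⟩
    rw [map_mul, ← h, ← mul_assoc, ← map_mul, hy, map_one, one_mul]
  | h₃ a q ha hq ih =>
    intro _ b c h
    rw [map_mul, mul_assoc] at h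
    obtain ⟨b', rfl⟩ := prime_step p j D hD hu hq _ h
    rw [map_mul] at h
    have hne : j q ≠ 0 := fun h0 => hq.ne_zero (hji (h0.trans (map_zero j).symm))
    exact ih ha b' c (mul_left_cancel₀ hne h)
end comm
end WA

namespace WA
set_option linter.unusedSectionVars false
set_option linter.unusedSimpArgs false
open MvPolynomial

section center
variable (p : ℕ) [Fact p.Prime]

lemma commute_pow_p2 {A : Type*} [Ring A] [Algebra (ZMod p) A] {x y : A} (h : y * x = x * y + 1) :
    y ^ p * x = x * y ^ p := by
  have := commute_pow_p p (swap_rel h)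
  simpa using this.symm

lemma cen_of_gens {R : Type*} [CommRing R] {t : WeylAlgebra R} (hx : t * gX R = gX R * t) (hy : t * gY R = gY R * t) :
    Cen t := by
  intro b
  have hx' : Commute t (gX R) := hx
  have hy' : Commute t (gY R) := hy
  show Commute t b
  induction b using weyl_induction with
  | hm m c => exact ((hx'.pow_right _).mul_right (hy'.pow_right _)).smul_right c
  | ha a b h1 h2 => exact h1.add_right h2

abbrev Cz := Subalgebra.center (ZMod p) (WeylAlgebra (ZMod p))

lemma gX_pow_cen : gX (ZMod p) ^ p ∈ Cz p := by
  rw [← cen_iff]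
  exact cen_of_gens ((Commute.refl _).pow_left p) (commute_pow_p p gY_mul_gX).symm

lemma gY_pow_cen : gY (ZMod p) ^ p ∈ Cz p := by
  rw [← cen_iff]
  refine cen_of_gens ?_ ((Commute.refl _).pow_left p)
  exact commute_pow_p2 p gY_mul_gX

noncomputable def io : MvPolynomial (Fin 2) (ZMod p) →ₐ[ZMod p] Cz p :=
  aeval ![⟨_, gX_pow_cen p⟩, ⟨_, gY_pow_cen p⟩]

lemma io_monomial (m : Fin 2 →₀ ℕ) (c : ZMod p) :
    (io p (monomial m c) : WeylAlgebra (ZMod p)) = c • mon _ (p • m) := by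
  have : monomial m c = c • (X 0 ^ m 0 * X 1 ^ m 1) := by
    rw [← monomial_eq', smul_monomial, smul_eq_mul, mul_one]
  rw [this, map_smul, map_mul, map_pow, map_pow]
  simp [io, mon, pow_mul]

lemma sig_io (F : MvPolynomial (Fin 2) (ZMod p)) : sig _ (io p F : WeylAlgebra (ZMod p)) = expand p F := by
  induction F using MvPolynomial.induction_on' with
  | monomial m c => rw [io_monomial, map_smul, sig_mon, expand_monomial, smul_monomial, smul_eq_mul, mul_one]
  | add f g hf hg => rw [map_add (expand p), ← hf, ← hg, ← map_add (sig _), map_add (io p)]; rfl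

lemma io_inj : Function.Injective (io p) := by
  intro f g h
  apply expand_injective (Fact.out : p.Prime).pos
  rw [← sig_io, h, sig_io]

lemma io_surj : Function.Surjective (io p) := by
  intro z
  have hz : Cen (z : WeylAlgebra (ZMod p)) := (cen_iff p).2 z.2
  obtain ⟨G, hG⟩ := exists_expand p (sig _ (z : WeylAlgebra (ZMod p))) (by
    intro i
    fin_cases i
    · show pderiv 0 _ = 0
      rw [← sig_comm_Y, hz, sub_self, map_zero]
    · show pderiv 1 _ = 0
      rw [← sig_comm_X, hz, sub_self, map_zero])
  refine ⟨G, Subtype.ext (sig_inj ?_)⟩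
  rw [sig_io, hG]

noncomputable def ioE : MvPolynomial (Fin 2) (ZMod p) ≃ₐ[ZMod p] Cz p :=
  AlgEquiv.ofBijective (io p) ⟨io_inj p, io_surj p⟩

instance : IsDomain (Cz p) := (ioE p).symm.toMulEquiv.isDomain _
instance : UniqueFactorizationMonoid (Cz p) := (ioE p).toMulEquiv.uniqueFactorizationMonoid inferInstance

lemma Cz_unit (u : Cz p) (hu : IsUnit u) : ∃ c : ZMod p, u = algebraMap _ _ c := by
  obtain ⟨v, hv⟩ := hu.exists_right_inv
  obtain ⟨c, hc⟩ := unit_const (congrArg Subtype.val hv)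
  exact ⟨c, Subtype.ext hc⟩

noncomputable def wspan (q : Fin p × Fin p) : WeylAlgebra (ZMod p) :=
  gX _ ^ (q.1 : ℕ) * gY _ ^ (q.2 : ℕ)

lemma hwspan : Submodule.span (Cz p) (Set.range (wspan p)) = ⊤ := by
  rw [eq_top_iff]
  rintro a -
  have hp := (Fact.out : p.Prime).pos
  induction a using weyl_induction with
  | hm m c =>
    have e : c • mon (ZMod p) m = (c • (io p (X 0 ^ (m 0 / p) * X 1 ^ (m 1 / p)))) •
        wspan p (⟨m 0 % p, Nat.mod_lt _ hp⟩, ⟨m 1 % p, Nat.mod_lt _ hp⟩) := by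
      rw [smul_assoc]
      congr 1
      have h1 : (io p (X 0 ^ (m 0 / p) * X 1 ^ (m 1 / p)) : WeylAlgebra (ZMod p)) =
          (gX _ ^ p) ^ (m 0 / p) * (gY _ ^ p) ^ (m 1 / p) := by simp [io]
      rw [Subalgebra.smul_def, h1, smul_eq_mul, wspan, mon]
      have hc : Cen ((gY (ZMod p) ^ p) ^ (m 1 / p)) :=
        (cen_iff p).2 (pow_mem (gY_pow_cen p) _)
      rw [mul_assoc, hc, mul_assoc, ← pow_mul, ← pow_mul, ← mul_assoc, ← pow_add, ← pow_add,
        Nat.div_add_mod, Nat.mod_add_div]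
    rw [e]
    exact Submodule.smul_mem _ _ (Submodule.subset_span ⟨_, rfl⟩)
  | ha a b h1 h2 => exact Submodule.add_mem _ h1 h2

lemma azuZ {x y : WeylAlgebra (ZMod p)} (h : y * x = x * y + 1) (a : WeylAlgebra (ZMod p)) :
    ∃ c : ℕ → ℕ → Cz p, a = ∑ i ∈ Finset.range p, x ^ i * ∑ j ∈ Finset.range p, y ^ j * c i j := by
  classical
  obtain ⟨c, hc, ha⟩ := azu p (wspan p) (hwspan p) h a
  refine ⟨fun i j => if hh : i < p ∧ j < p then ⟨c i j, (cen_iff p).1 (hc i hh.1 j hh.2)⟩ else 0, ?_⟩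
  rw [ha]
  refine Finset.sum_congr rfl fun i hi => ?_
  congr 1
  refine Finset.sum_congr rfl fun j hj => ?_
  rw [Finset.mem_range] at hi hj
  simp [hi, hj]

lemma indepZ {x y : WeylAlgebra (ZMod p)} (h : y * x = x * y + 1) (c d : ℕ → ℕ → Cz p)
    (h0 : ∑ i ∈ Finset.range p, x ^ i * ∑ j ∈ Finset.range p, y ^ j * (c i j : WeylAlgebra (ZMod p)) =
      ∑ i ∈ Finset.range p, x ^ i * ∑ j ∈ Finset.range p, y ^ j * (d i j : WeylAlgebra (ZMod p))) :
    ∀ i < p, ∀ j < p, c i j = d i j := by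
  intro i hi j hj
  have := indep2 p h (fun i j => ((c i j - d i j : Cz p) : WeylAlgebra (ZMod p)))
    (fun i j => (cen_iff p).2 (c i j - d i j).2) (by
      rw [← sub_eq_zero, ← Finset.sum_sub_distrib] at h0
      rw [← h0]
      refine Finset.sum_congr rfl fun i hi => ?_
      rw [← mul_sub, ← Finset.sum_sub_distrib]
      congr 1
      refine Finset.sum_congr rfl fun j hj => ?_
      rw [← mul_sub]; rfl) i hi j hj
  exact sub_eq_zero.1 (Subtype.ext this)

lemma exists_cen_mul (P : WeylAlgebra (ZMod p)) (hP : P ≠ 0) :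
    ∃ (z : Cz p) (t : WeylAlgebra (ZMod p)), z ≠ 0 ∧ t * P = z := by
  classical
  let _ : Algebra (Cz p) (WeylAlgebra (ZMod p)) := Algebra.ofModule (fun r x y => smul_mul_assoc r x y) (fun r x y => by
    have hc : Cen (r : WeylAlgebra (ZMod p)) := (cen_iff p).2 r.2
    rw [Subalgebra.smul_def, Subalgebra.smul_def, smul_eq_mul, smul_eq_mul, ← mul_assoc, ← hc, mul_assoc])
  have hfin : Module.Finite (Cz p) (WeylAlgebra (ZMod p)) :=
    ⟨⟨Finset.univ.image (wspan p), by simpa using hwspan p⟩⟩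
  have hint : IsIntegral (Cz p) P := Algebra.IsIntegral.isIntegral P
  obtain ⟨r, hr, t, ht⟩ := hint.isAlgebraic.exists_nonzero_dvd (mem_nonZeroDivisors_of_ne_zero hP)
  refine ⟨r, t, hr, ?_⟩
  have hc : Cen (r : WeylAlgebra (ZMod p)) := (cen_iff p).2 r.2
  have h2 : (r : WeylAlgebra (ZMod p)) = P * t := by
    rw [← ht, Algebra.algebraMap_eq_smul_one, Subalgebra.smul_def, smul_eq_mul, mul_one]
  apply mul_left_cancel₀ hP
  rw [← mul_assoc, ← h2, hc]

section main
lemma mkD {Z : Type*} [CommRing Z] (d1 d2 : Z → Z) (h1 : ∀ a b, d1 (a + b) = d1 a + d1 b)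
    (h2 : ∀ a b, d2 (a + b) = d2 a + d2 b) (m1 : ∀ a b, d1 (a * b) = a * d1 b + b * d1 a)
    (m2 : ∀ a b, d2 (a * b) = a * d2 b + b * d2 a) :
    ∃ D : Fin 2 → Derivation ℤ Z Z, (∀ z, D 0 z = d1 z) ∧ (∀ z, D 1 z = d2 z) :=
  ⟨![Derivation.mk' (AddMonoidHom.mk' d1 h1).toIntLinearMap m1,
    Derivation.mk' (AddMonoidHom.mk' d2 h2).toIntLinearMap m2], fun _ => rfl, fun _ => rfl⟩

variable {W : Type*} [Ring W] (π : W →+* WeylAlgebra (ZMod p)) (hsurj : Function.Surjective π)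
    (hker : ∀ w, π w = 0 → ∃ v, w = (p : W) * v) (hnzd : ∀ w : W, (p : W) * w = 0 → w = 0)
    {x y : W} (h : y * x = x * y + 1)

lemma lift_mul_sum {x y : WeylAlgebra (ZMod p)} (h : y * x = x * y + 1) (c : ℕ → ℕ → WeylAlgebra (ZMod p)) :
    lift (R := ZMod p) x y h (∑ i ∈ Finset.range p, gX _ ^ i * ∑ j ∈ Finset.range p, gY _ ^ j * c i j) =
      ∑ i ∈ Finset.range p, x ^ i * ∑ j ∈ Finset.range p, y ^ j * lift (R := ZMod p) x y h (c i j) := by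
  simp only [map_sum, map_mul, map_pow, lift_gX, lift_gY]

lemma map_rel (h : y * x = x * y + 1) : π y * π x = π x * π y + 1 := by
  rw [← map_mul, h, map_add, map_mul, map_one]

lemma char_p (hsurj : Function.Surjective π)
    (hker : ∀ w, π w = 0 → ∃ v, w = (p : W) * v) (hnzd : ∀ w : W, (p : W) * w = 0 → w = 0)
    (h : y * x = x * y + 1) (P Q a : WeylAlgebra (ZMod p)) (hP : P ≠ 0)
    (ha : lift (R := ZMod p) (π x) (π y) (map_rel p π h) P * a =
      lift (R := ZMod p) (π x) (π y) (map_rel p π h) Q) :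
    ∃ a', a = lift (R := ZMod p) (π x) (π y) (map_rel p π h) a' ∧ P * a' = Q := by
  have h' := map_rel p π h
  set ψ := lift (R := ZMod p) (π x) (π y) (map_rel p π h) with hψ
  obtain ⟨hxc, hyc⟩ := azu_pow_cen p (wspan p) (hwspan p) h'
  rw [cen_iff p] at hxc hyc
  let j : MvPolynomial (Fin 2) (ZMod p) →ₐ[ZMod p] Cz p := aeval ![⟨_, hxc⟩, ⟨_, hyc⟩]
  have hj : ∀ F, (j F : WeylAlgebra (ZMod p)) = ψ (io p F) := by
    intro F
    have : (Subalgebra.val _).comp j = ψ.comp ((Subalgebra.val _).comp (io p)) := by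
      apply MvPolynomial.algHom_ext
      intro i
      fin_cases i <;> simp [j, io, hψ]
    exact DFunLike.congr_fun this F
  obtain ⟨D1, D2, e1, e2, e3, e4⟩ := exists_D12 p π hsurj hker hnzd h ⟨_, hxc⟩ ⟨_, hyc⟩ rfl rfl
  obtain ⟨D, hD0, hD1⟩ := mkD (Z := Cz p) D1 D2 (map_add D1) (map_add D2) (D1.leibniz) (D2.leibniz)
  have hD : ∀ i k, D i (j (X k)) = if i = k then 1 else 0 := by
    intro i k
    have hX0 : j (X 0) = ⟨_, hxc⟩ := by simp [j]
    have hX1 : j (X 1) = ⟨_, hyc⟩ := by simp [j]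
    fin_cases i <;> fin_cases k
    · exact (hD0 _).trans ((congrArg D1 hX0).trans e1)
    · exact (hD0 _).trans ((congrArg D1 hX1).trans e2)
    · exact (hD1 _).trans ((congrArg D2 hX0).trans e3)
    · exact (hD1 _).trans ((congrArg D2 hX1).trans e4)
  have hji := j_inj p j D hD
  have hcm := comm_main p j D hD (Cz_unit p)
  -- decomposition with central coordinates
  have dec : ∀ b : WeylAlgebra (ZMod p), ∃ F : ℕ → ℕ → MvPolynomial (Fin 2) (ZMod p),
      b = ∑ i ∈ Finset.range p, gX _ ^ i * ∑ j ∈ Finset.range p, gY _ ^ j * (io p (F i j) : WeylAlgebra (ZMod p)) := by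
    intro b
    obtain ⟨c, hc⟩ := azuZ p gY_mul_gX b
    choose F hF using fun i j => io_surj p (c i j)
    exact ⟨F, by simp only [hF]; exact hc⟩
  have hψi : Function.Injective ψ := by
    rw [injective_iff_map_eq_zero]
    intro b hb
    obtain ⟨F, rfl⟩ := dec b
    rw [hψ, lift_mul_sum p h', ← hψ] at hb
    simp only [← hj] at hb
    have := indepZ p h' (fun i k => j (F i k)) (fun _ _ => 0) (by rw [hb]; simp)
    refine Finset.sum_eq_zero fun i hi => ?_
    rw [Finset.sum_eq_zero, mul_zero]
    intro k hk
    have h0 := this i (Finset.mem_range.1 hi) k (Finset.mem_range.1 hk)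
    rw [hji (h0.trans (map_zero j).symm)]
    simp
  obtain ⟨z, t, hz, htz⟩ := exists_cen_mul p P hP
  obtain ⟨θ, rfl⟩ := io_surj p z
  have hθ : θ ≠ 0 := by rintro rfl; exact hz (map_zero _)
  have hθa : (j θ : WeylAlgebra (ZMod p)) * a = ψ (t * Q) := by
    rw [hj, ← htz, map_mul, mul_assoc, ha, map_mul]
  have hθc : Cen (j θ : WeylAlgebra (ZMod p)) := (cen_iff p).2 (j θ).2
  obtain ⟨B, hB⟩ := dec (t * Q)
  obtain ⟨c, hc⟩ := azuZ p h' a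
  have hcoef : ∀ i < p, ∀ k < p, j θ * c i k = j (B i k) := by
    apply indepZ p h' (fun i k => j θ * c i k) (fun i k => j (B i k))
    rw [hB, hψ, lift_mul_sum p h', ← hψ] at hθa
    simp only [← hj] at hθa
    rw [← hθa]
    conv_rhs => rw [hc]
    rw [Finset.mul_sum]
    refine Finset.sum_congr rfl fun i hi => ?_
    rw [← mul_assoc, hθc, mul_assoc]
    congr 1
    rw [Finset.mul_sum]
    refine Finset.sum_congr rfl fun k hk => ?_
    rw [← mul_assoc, hθc, mul_assoc]
    rfl
  have hex : ∀ i k, ∃ G, i < p → k < p → c i k = j G := by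
    intro i k
    by_cases hh : i < p ∧ k < p
    · obtain ⟨G, hG⟩ := hcm θ hθ _ _ (hcoef i hh.1 k hh.2)
      exact ⟨G, fun _ _ => hG⟩
    · exact ⟨0, fun h1 h2 => absurd ⟨h1, h2⟩ hh⟩
  choose G hG using hex
  have hres : a = ψ (∑ i ∈ Finset.range p, gX _ ^ i * ∑ k ∈ Finset.range p, gY _ ^ k *
      (io p (G i k) : WeylAlgebra (ZMod p))) := by
    rw [hψ, lift_mul_sum p h', ← hψ]
    simp only [← hj]
    conv_lhs => rw [hc]
    refine Finset.sum_congr rfl fun i hi => ?_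
    congr 1
    refine Finset.sum_congr rfl fun k hk => ?_
    rw [hG i k (Finset.mem_range.1 hi) (Finset.mem_range.1 hk)]
  refine ⟨_, hres, hψi ?_⟩
  rw [map_mul, ← hres, ha]
end main

end center
end WA

namespace WA
set_option linter.unusedSectionVars false
set_option linter.unusedSimpArgs false
open MvPolynomial

section bc
variable {R R' R'' : Type*} [CommRing R] [CommRing R'] [CommRing R'']

lemma exists_bc (φ : R →+* R') : ∃ f : WeylAlgebra R →+* WeylAlgebra R',
    (∀ (c : R) a, f (c • a) = φ c • f a) ∧ f (gX R) = gX R' ∧ f (gY R) = gY R' := by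
  let _ : Algebra R R' := φ.toAlgebra
  refine ⟨(lift (R := R) (gX R') (gY R') gY_mul_gX).toRingHom, ?_, ?_, ?_⟩
  · intro c a
    have := map_smul (lift (R := R) (gX R') (gY R') gY_mul_gX) c a
    refine this.trans ?_
    rw [← algebraMap_smul R' c]
    rfl
  · exact lift_gX _ _ _
  · exact lift_gY _ _ _

noncomputable def bc (φ : R →+* R') : WeylAlgebra R →+* WeylAlgebra R' := (exists_bc φ).choose

lemma bc_smul (φ : R →+* R') (c : R) (a : WeylAlgebra R) : bc φ (c • a) = φ c • bc φ a :=
  (exists_bc φ).choose_spec.1 c a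

lemma bc_gX (φ : R →+* R') : bc φ (gX R) = gX R' := (exists_bc φ).choose_spec.2.1
lemma bc_gY (φ : R →+* R') : bc φ (gY R) = gY R' := (exists_bc φ).choose_spec.2.2

lemma bc_mon (φ : R →+* R') (m) : bc φ (mon R m) = mon R' m := by
  simp [mon, bc_gX, bc_gY]

lemma sig_bc (φ : R →+* R') (a : WeylAlgebra R) : sig R' (bc φ a) = map φ (sig R a) := by
  induction a using weyl_induction with
  | hm m c => rw [bc_smul, bc_mon, map_smul, map_smul, sig_mon, sig_mon, smul_monomial, smul_monomial, map_monomial]; simp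
  | ha a b h1 h2 => rw [map_add (bc φ), map_add (sig R'), h1, h2, map_add (sig R), map_add (map φ)]

lemma bc_inj (φ : R →+* R') (h : Function.Injective φ) : Function.Injective (bc φ) := by
  intro a b hab
  apply sig_inj
  apply map_injective φ h
  rw [← sig_bc, hab, sig_bc]

lemma bc_bc (φ : R →+* R') (χ : R' →+* R'') (a : WeylAlgebra R) : bc χ (bc φ a) = bc (χ.comp φ) a := by
  apply sig_inj
  rw [sig_bc, sig_bc, sig_bc, map_map]

lemma bc_range (φ : R →+* R') (a : WeylAlgebra R') (h : ∀ m ∈ (sig R' a).support, coeff m (sig R' a) ∈ Set.range φ) :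
    ∃ b, bc φ b = a := by
  choose! f hf using h
  refine ⟨tau R (∑ m ∈ (sig R' a).support, monomial m (f m)), ?_⟩
  apply sig_inj
  rw [sig_bc, sig_tau, map_sum]
  conv_rhs => rw [(sig R' a).as_sum]
  refine Finset.sum_congr rfl fun m hm => ?_
  rw [map_monomial, hf m hm]

lemma bc_rel (φ : R →+* R') {x y : WeylAlgebra R} (h : y * x = x * y + 1) :
    bc φ y * bc φ x = bc φ x * bc φ y + 1 := by
  rw [← map_mul, h, map_add, map_mul, map_one]

lemma lift_mon {x y : WeylAlgebra R} (h : y * x = x * y + 1) (m) :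
    lift (R := R) x y h (mon R m) = x ^ m 0 * y ^ m 1 := by
  simp [mon]

lemma bc_lift (φ : R →+* R') {x y : WeylAlgebra R} (h : y * x = x * y + 1) (a : WeylAlgebra R) :
    bc φ (lift (R := R) x y h a) = lift (R := R') (bc φ x) (bc φ y) (bc_rel φ h) (bc φ a) := by
  induction a using weyl_induction with
  | hm m c => rw [map_smul, bc_smul, bc_smul, bc_mon, map_smul, lift_mon, lift_mon, map_mul, map_pow, map_pow]
  | ha a b h1 h2 => rw [map_add, map_add, h1, h2, map_add (bc φ), map_add]

noncomputable def Lf (T : Finset (Fin 2 →₀ ℕ)) (l : (Fin 2 →₀ ℕ) → R) : WeylAlgebra R →ₗ[R] R :=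
  ∑ m ∈ T, l m • ((lcoeff R m).comp (sig R))

lemma Lf_apply (T : Finset (Fin 2 →₀ ℕ)) (l : (Fin 2 →₀ ℕ) → R) (a : WeylAlgebra R) :
    Lf T l a = ∑ m ∈ T, l m * coeff m (sig R a) := by
  simp [Lf]

lemma Lf_bc (φ : R →+* R') (T : Finset (Fin 2 →₀ ℕ)) (l : (Fin 2 →₀ ℕ) → R) (a : WeylAlgebra R) :
    Lf T (fun m => φ (l m)) (bc φ a) = φ (Lf T l a) := by
  rw [Lf_apply, Lf_apply, map_sum]
  refine Finset.sum_congr rfl fun m _ => ?_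
  rw [sig_bc, coeff_map, map_mul]

lemma as_sum (a : WeylAlgebra R) : a = ∑ m ∈ (sig R a).support, coeff m (sig R a) • mon R m := by
  conv_lhs => rw [← tau_sig a, (sig R a).as_sum, map_sum]
  simp only [tau_monomial]

end bc

section padic
variable (p : ℕ) [Fact p.Prime]

lemma bc_toZMod_surj : Function.Surjective (bc (PadicInt.toZMod (p := p))) := by
  intro a
  refine bc_range _ a fun m _ => ?_
  exact ZMod.ringHom_surjective _ _

lemma bc_toZMod_ker (w) (h : bc (PadicInt.toZMod (p := p)) w = 0) :
    ∃ v, w = (p : WeylAlgebra ℤ_[p]) * v := by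
  have h1 : map (PadicInt.toZMod (p := p)) (sig _ w) = 0 := by rw [← sig_bc, h, map_zero]
  have h2 : C (p : ℤ_[p]) ∣ sig _ w := by
    rw [C_dvd_iff_dvd_coeff]
    intro m
    have : coeff m (sig _ w) ∈ RingHom.ker (PadicInt.toZMod (p := p)) := by
      rw [RingHom.mem_ker, ← coeff_map, h1, coeff_zero]
    rwa [PadicInt.ker_toZMod, PadicInt.maximalIdeal_eq_span_p, Ideal.mem_span_singleton] at this
  obtain ⟨v, hv⟩ := h2
  refine ⟨tau _ v, sig_inj ?_⟩
  rw [hv, ← nsmul_eq_mul, map_nsmul, sig_tau, nsmul_eq_mul]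
  simp

lemma bc_p_nzd (w : WeylAlgebra ℤ_[p]) (h : (p : WeylAlgebra ℤ_[p]) * w = 0) : w = 0 := by
  apply sig_inj
  rw [map_zero]
  have := congrArg (sig _) h
  rw [← nsmul_eq_mul, map_nsmul, map_zero, nsmul_eq_mul, mul_eq_zero] at this
  refine this.resolve_left ?_
  exact Nat.cast_ne_zero.2 (Fact.out : p.Prime).ne_zero

end padic

section final
variable {K : Type*} [Field K] [CharZero K]

set_option maxHeartbeats 2000000 in
lemma final (cas : ∀ S : Finset K, ∃ (p : ℕ) (_ : Fact p.Prime), Nonempty (Algebra.adjoin ℤ (S : Set K) →+* ℤ_[p]))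
    {x y : WeylAlgebra K} (h : y * x = x * y + 1) (P Q a : WeylAlgebra K) (hP : P ≠ 0)
    (hPQ : lift (R := K) x y h P * a = lift (R := K) x y h Q) : a ∈ (lift (R := K) x y h).range := by
  classical
  by_contra hna
  set N := (sig K Q).totalDegree with hN
  have hfin : {m : Fin 2 →₀ ℕ | m.degree ≤ N}.Finite := Finsupp.finite_of_degree_le N
  let V : Submodule K (WeylAlgebra K) := Submodule.span K {b | ∃ m : Fin 2 →₀ ℕ, m.degree ≤ N ∧ b = x ^ m 0 * y ^ m 1}
  have haV : a ∉ V := by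
    intro ha
    apply hna
    have : V ≤ Subalgebra.toSubmodule (lift (R := K) x y h).range := by
      rw [Submodule.span_le]
      rintro _ ⟨m, _, rfl⟩
      exact ⟨mon K m, lift_mon h m⟩
    exact this ha
  obtain ⟨lam, hl1, hl2⟩ := Submodule.exists_le_ker_of_notMem haV
  let l : (Fin 2 →₀ ℕ) → K := fun m => (lam a)⁻¹ * lam (mon K m)
  let M := hfin.toFinset
  let T : Finset (Fin 2 →₀ ℕ) := (sig K a).support ∪ M.biUnion (fun m => (sig K (x ^ m 0 * y ^ m 1)).support)
  have hLf : ∀ b : WeylAlgebra K, (sig K b).support ⊆ T → Lf T l b = (lam a)⁻¹ * lam b := by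
    intro b hb
    rw [Lf_apply, ← Finset.sum_subset hb]
    · conv_rhs => rw [as_sum b, map_sum, Finset.mul_sum]
      refine Finset.sum_congr rfl fun m _ => ?_
      rw [map_smul, smul_eq_mul]
      simp only [l]; ring
    · intro m _ hm
      rw [notMem_support_iff.1 hm, mul_zero]
  have hLa : Lf T l a = 1 := by
    rw [hLf a Finset.subset_union_left, inv_mul_cancel₀ hl1]
  have hLm : ∀ m : Fin 2 →₀ ℕ, m.degree ≤ N → Lf T l (x ^ m 0 * y ^ m 1) = 0 := by
    intro m hm
    rw [hLf]
    · have : x ^ m 0 * y ^ m 1 ∈ LinearMap.ker lam := hl2 (Submodule.subset_span ⟨m, hm, rfl⟩)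
      rw [LinearMap.mem_ker.1 this, mul_zero]
    · refine Finset.Subset.trans ?_ Finset.subset_union_right
      exact Finset.subset_biUnion_of_mem (fun m : Fin 2 →₀ ℕ => (sig K (x ^ m 0 * y ^ m 1)).support) (hfin.mem_toFinset.2 hm)
  have hP0 : sig K P ≠ 0 := fun h0 => hP (sig_inj (h0.trans (map_zero _).symm))
  obtain ⟨m0, hm0⟩ := MvPolynomial.ne_zero_iff.1 hP0
  let cs : WeylAlgebra K → Finset K := fun b => (sig K b).support.image (fun m => coeff m (sig K b))
  let S : Finset K := cs x ∪ cs y ∪ cs a ∪ cs P ∪ cs Q ∪ T.image l ∪ {(coeff m0 (sig K P))⁻¹}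
  obtain ⟨p, hp, ⟨χ0⟩⟩ := cas S
  set R := Algebra.adjoin ℤ (S : Set K) with hR
  let inc : R →+* K := R.val.toRingHom
  have hinc : Function.Injective inc := Subtype.val_injective
  have hSr : ∀ s ∈ S, s ∈ Set.range inc := fun s hs => ⟨⟨s, Algebra.subset_adjoin hs⟩, rfl⟩
  have hlift : ∀ b : WeylAlgebra K, cs b ⊆ S → ∃ b', bc inc b' = b := by
    intro b hb
    refine bc_range inc b fun m hm => hSr _ (hb ?_)
    exact Finset.mem_image_of_mem _ hm
  obtain ⟨x', hx⟩ := hlift x (fun s hs => by simp only [S, Finset.mem_union]; tauto)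
  obtain ⟨y', hy⟩ := hlift y (fun s hs => by simp only [S, Finset.mem_union]; tauto)
  obtain ⟨a', ha⟩ := hlift a (fun s hs => by simp only [S, Finset.mem_union]; tauto)
  obtain ⟨P', hPP⟩ := hlift P (fun s hs => by simp only [S, Finset.mem_union]; tauto)
  obtain ⟨Q', hQQ⟩ := hlift Q (fun s hs => by simp only [S, Finset.mem_union]; tauto)
  have hl' : ∀ m, ∃ r : R, m ∈ T → inc r = l m := by
    intro m
    by_cases hm : m ∈ T
    · obtain ⟨r, hr⟩ := hSr (l m) (by
        have := Finset.mem_image_of_mem l hm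
        simp only [S, Finset.mem_union]; tauto)
      exact ⟨r, fun _ => hr⟩
    · exact ⟨0, fun h => absurd h hm⟩
  choose l' hl' using hl'
  obtain ⟨u, hu⟩ := hSr (coeff m0 (sig K P))⁻¹ (by simp [S])
  have hLf' : ∀ b : WeylAlgebra R, inc (Lf T l' b) = Lf T l (bc inc b) := by
    intro b
    rw [← Lf_bc, Lf_apply, Lf_apply]
    exact Finset.sum_congr rfl fun m hm => by rw [hl' m hm]
  have h' : y' * x' = x' * y' + 1 := by
    apply bc_inj inc hinc
    rw [map_mul, map_add, map_mul, map_one, hx, hy, h]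
  have hPQ' : lift (R := R) x' y' h' P' * a' = lift (R := R) x' y' h' Q' := by
    apply bc_inj inc hinc
    rw [map_mul, bc_lift, bc_lift]
    simp only [hx, hy, ha, hPP, hQQ]
    exact hPQ
  have hLa' : Lf T l' a' = 1 := by
    apply hinc
    rw [hLf', ha, hLa, map_one]
  have hLm' : ∀ m : Fin 2 →₀ ℕ, m.degree ≤ N → Lf T l' (x' ^ m 0 * y' ^ m 1) = 0 := by
    intro m hm
    apply hinc
    rw [hLf', map_mul, map_pow, map_pow, hx, hy, hLm m hm, map_zero]
  have hu' : u * coeff m0 (sig R P') = 1 := by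
    apply hinc
    rw [map_mul, hu, map_one, ← coeff_map, ← sig_bc, hPP, inv_mul_cancel₀ hm0]
  have hdeg : (sig R Q').totalDegree ≤ N := by
    rw [hN, ← hQQ, sig_bc]
    simp only [totalDegree, support_map_of_injective _ hinc]
    exact le_rfl
  -- pass to characteristic p
  let π := bc (PadicInt.toZMod (p := p))
  let χ : R →+* ZMod p := (PadicInt.toZMod (p := p)).comp χ0
  have hχ : ∀ b, π (bc χ0 b) = bc χ b := fun b => bc_bc _ _ _
  have hPp : bc χ P' ≠ 0 := by
    intro h0
    have h1 : coeff m0 (sig _ (bc χ P')) = 0 := by rw [h0, map_zero, coeff_zero]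
    rw [sig_bc, coeff_map] at h1
    have h2 := congrArg χ hu'
    rw [map_mul, h1, mul_zero, map_one] at h2
    exact zero_ne_one h2
  obtain ⟨c, hc, hPc⟩ := char_p p π (bc_toZMod_surj p) (bc_toZMod_ker p) (bc_p_nzd p)
    (x := bc χ0 x') (y := bc χ0 y') (bc_rel χ0 h') (bc χ P') (bc χ Q') (bc χ a') hPp (by
      simp only [hχ]
      rw [← bc_lift χ h', ← bc_lift χ h', ← map_mul, hPQ'])
  have hcdeg : (sig _ c).totalDegree ≤ N := by
    by_cases hc0 : c = 0
    · simp [hc0]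
    · have h1 := (totalDegree_sig_mul hPp hc0).2
      rw [hPc, sig_bc] at h1
      have h2 : (map χ (sig R Q')).totalDegree ≤ (sig R Q').totalDegree := by
        simp only [totalDegree]
        exact Finset.sup_mono (support_map_subset _ _)
      omega
  have e1 : Lf T (fun m => χ (l' m)) (bc χ a') = 1 := by rw [Lf_bc, hLa', map_one]
  have e2 : Lf T (fun m => χ (l' m)) (bc χ a') = 0 := by
    rw [hc, as_sum c, map_sum, map_sum]
    refine Finset.sum_eq_zero fun m hm => ?_
    have hmd : m.degree ≤ N := (le_totalDegree hm).trans hcdeg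
    rw [map_smul, map_smul, lift_mon, hχ, hχ, ← map_pow, ← map_pow, ← map_mul, Lf_bc, hLm' m hmd, map_zero, smul_zero]
  rw [e1] at e2
  exact one_ne_zero e2
end final
end WA

namespace WA
open Polynomial

lemma finite_values {f : ℤ[X]} (hf : 0 < f.natDegree) (c : ℤ) : {n : ℤ | f.eval n = c}.Finite := by
  have hne : f - C c ≠ 0 := by
    intro h
    rw [sub_eq_zero.1 h, natDegree_C] at hf
    exact lt_irrefl _ hf
  refine (f - C c).roots.toFinset.finite_toSet.subset ?_
  intro n hn
  simp only [Finset.mem_coe, Multiset.mem_toFinset, mem_roots hne, IsRoot, eval_sub, eval_C]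
  exact sub_eq_zero.2 hn

lemma prime_divisor {f : ℤ[X]} (hf : 0 < f.natDegree) (B : ℕ) :
    ∃ p : ℕ, p.Prime ∧ B < p ∧ ∃ n : ℤ, (p : ℤ) ∣ f.eval n := by
  obtain ⟨n0, hn0⟩ := (finite_values hf 0).infinite_compl.nonempty
  set c := f.eval n0 with hc
  have hc0 : c ≠ 0 := hn0
  have hB0 : (B.factorial : ℤ) ≠ 0 := by exact_mod_cast B.factorial_ne_zero
  have hd0 : c * B.factorial ≠ 0 := mul_ne_zero hc0 hB0
  have hfin : {t : ℤ | f.eval (n0 + c * B.factorial * t) = c ∨ f.eval (n0 + c * B.factorial * t) = -c}.Finite := by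
    have := (finite_values hf c).union (finite_values hf (-c))
    refine Set.Finite.subset (this.preimage (f := fun t : ℤ => n0 + c * B.factorial * t) ?_) ?_
    · intro a _ b _ hab
      exact mul_left_cancel₀ hd0 (add_left_cancel hab)
    · intro t ht; exact ht
  obtain ⟨t, ht⟩ := hfin.infinite_compl.nonempty
  simp only [Set.mem_compl_iff, Set.mem_setOf_eq, not_or] at ht
  obtain ⟨k, hk⟩ := sub_dvd_eval_sub (n0 + c * B.factorial * t) n0 f
  have e : f.eval (n0 + c * B.factorial * t) = c * (1 + B.factorial * (t * k)) := by
    linear_combination hk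
  have hna : (1 + B.factorial * (t * k) : ℤ).natAbs ≠ 1 := by
    intro h
    rcases Int.natAbs_eq_iff.1 h with h1 | h1
    · exact ht.1 (by rw [e, h1]; simp)
    · exact ht.2 (by rw [e, h1]; simp)
  obtain ⟨p, hp, hpd⟩ := Nat.exists_prime_and_dvd hna
  have hpd' : (p : ℤ) ∣ 1 + B.factorial * (t * k) := Int.natCast_dvd.2 hpd
  refine ⟨p, hp, ?_, n0 + c * B.factorial * t, by rw [e]; exact hpd'.mul_left _⟩
  by_contra hle
  have h1 : (p : ℤ) ∣ B.factorial := Int.natCast_dvd_natCast.2 ((hp.dvd_factorial).2 (by omega))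
  have h2 : (p : ℤ) ∣ 1 := (Int.dvd_add_left (h1.mul_right _)).1 hpd'
  exact hp.one_lt.ne' (by exact_mod_cast Int.eq_one_of_dvd_one (by positivity) h2)

lemma clear_denoms (g : ℚ[X]) : ∃ (d : ℤ) (G : ℤ[X]), d ≠ 0 ∧ G.map (Int.castRingHom ℚ) = C (d : ℚ) * g := by
  obtain ⟨⟨b, hb⟩, h⟩ := IsLocalization.integerNormalization_map_to_map (nonZeroDivisors ℤ) g
  refine ⟨b, IsLocalization.integerNormalization (nonZeroDivisors ℤ) g, nonZeroDivisors.ne_zero hb, ?_⟩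
  have e : (Int.castRingHom ℚ) = algebraMap ℤ ℚ := rfl
  rw [e, h]
  ext n
  simp [Algebra.smul_def]

lemma numfield {F : Type*} [Field F] [Algebra ℚ F] [Module.Finite ℚ F] (S : Finset F) :
    ∃ (p : ℕ) (_ : Fact p.Prime) (g : F →+* ℚ_[p]), ∀ s ∈ S, ‖g s‖ ≤ 1 := by
  classical
  let pb := Field.powerBasisOfFiniteOfSeparable ℚ F
  let m := minpoly ℚ pb.gen
  have hint : IsIntegral ℚ pb.gen := Algebra.IsIntegral.isIntegral _
  have hsep : m.Separable := Algebra.IsSeparable.isSeparable ℚ pb.gen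
  obtain ⟨u, v, huv⟩ := hsep
  obtain ⟨d, f, hd, hf⟩ := clear_denoms m
  obtain ⟨du, U, hdu, hU⟩ := clear_denoms u
  obtain ⟨dv, V, hdv, hV⟩ := clear_denoms v
  have hinj : Function.Injective (Int.castRingHom ℚ) := Int.cast_injective
  have hbez : C dv * U * f + C du * V * derivative f = C (d * du * dv) := by
    apply Polynomial.map_injective _ hinj
    simp only [Polynomial.map_add, Polynomial.map_mul, Polynomial.map_C, ← derivative_map, hf, hU, hV, derivative_C_mul]
    have : (C (Int.castRingHom ℚ (d * du * dv)) : ℚ[X]) = C (d : ℚ) * C (du : ℚ) * C (dv : ℚ) := by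
      simp [C_mul]
    rw [this]
    simp only [eq_intCast]
    linear_combination C (d : ℚ) * C (du : ℚ) * C (dv : ℚ) * huv
  have hdeg : 0 < f.natDegree := by
    have h1 : (f.map (Int.castRingHom ℚ)).natDegree = f.natDegree := natDegree_map_eq_of_injective hinj f
    rw [← h1, hf, natDegree_C_mul (by exact_mod_cast hd)]
    exact minpoly.natDegree_pos hint
  have hS : ∀ s : F, ∃ y : ℤ, y ≠ 0 ∧ IsIntegral ℤ (y • s) := by
    intro s
    have h1 : IsAlgebraic ℤ s := (IsFractionRing.isAlgebraic_iff ℤ ℚ F).2 (Algebra.IsAlgebraic.isAlgebraic s)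
    obtain ⟨y, hy, h⟩ := h1.exists_integral_multiple
    exact ⟨y, hy, h⟩
  choose N hN0 hN using hS
  set E : ℤ := d * du * dv * ∏ s ∈ S, N s with hE
  have hE0 : E ≠ 0 := mul_ne_zero (mul_ne_zero (mul_ne_zero hd hdu) hdv) (Finset.prod_ne_zero_iff.2 fun s _ => hN0 s)
  obtain ⟨p, hp, hB, n, hn⟩ := prime_divisor hdeg E.natAbs
  have : Fact p.Prime := ⟨hp⟩
  have hpE : ¬ (p : ℤ) ∣ E := by
    intro h
    have := Nat.le_of_dvd (Int.natAbs_pos.2 hE0) (Int.natCast_dvd.1 h)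
    omega
  have hn1 : ‖((f.eval n : ℤ) : ℤ_[p])‖ < 1 := (PadicInt.norm_int_lt_one_iff_dvd _).2 hn
  have hn2 : ‖((f.derivative.eval n : ℤ) : ℤ_[p])‖ = 1 := by
    by_contra hne
    have hlt : ‖((f.derivative.eval n : ℤ) : ℤ_[p])‖ < 1 := lt_of_le_of_ne (PadicInt.norm_le_one _) hne
    rw [PadicInt.norm_int_lt_one_iff_dvd] at hlt
    have e := congrArg (eval n) hbez
    simp only [eval_add, eval_mul, eval_C] at e
    apply hpE
    rw [hE, ← e]
    exact (dvd_add (hn.mul_left _) (hlt.mul_left _)).mul_right _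
  have ea : ∀ G : ℤ[X], aeval (n : ℤ_[p]) G = ((G.eval n : ℤ) : ℤ_[p]) := by
    intro G
    have := aeval_algebraMap_apply ℤ_[p] n G
    simpa using this
  obtain ⟨z, hz, -⟩ := hensels_lemma (p := p) (F := f) (a := (n : ℤ_[p])) (by
    rw [ea, ea, hn2]; simpa using hn1)
  have hroot : aeval (z : ℚ_[p]) m = 0 := by
    have h1 : aeval (z : ℚ_[p]) f = 0 := by
      have := aeval_algebraMap_apply ℚ_[p] z f
      rw [hz, map_zero] at this
      exact this
    have h2 : aeval (z : ℚ_[p]) (f.map (Int.castRingHom ℚ)) = 0 := by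
      rw [← h1]
      exact aeval_map_algebraMap ℚ _ f
    rw [hf, map_mul, aeval_C, mul_eq_zero] at h2
    refine h2.resolve_left ?_
    simpa using hd
  let g : F →ₐ[ℚ] ℚ_[p] := pb.lift (z : ℚ_[p]) hroot
  refine ⟨p, ‹_›, g.toRingHom, fun s hs => ?_⟩
  show ‖g s‖ ≤ 1
  have h1 : IsIntegral ℤ (g (N s • s)) := (hN s).map (g.restrictScalars ℤ)
  have h2 : IsIntegral ℤ_[p] (g (N s • s)) := h1.tower_top
  obtain ⟨w, hw⟩ := IsIntegrallyClosed.isIntegral_iff.1 h2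
  have h3 : ‖g (N s • s)‖ ≤ 1 := by rw [← hw]; exact PadicInt.norm_le_one w
  have h4 : ‖((N s : ℤ) : ℚ_[p])‖ = 1 := by
    rw [← PadicInt.coe_intCast, ← PadicInt.norm_def]
    by_contra hne
    have hlt : ‖((N s : ℤ) : ℤ_[p])‖ < 1 := lt_of_le_of_ne (PadicInt.norm_le_one _) hne
    rw [PadicInt.norm_int_lt_one_iff_dvd] at hlt
    exact hpE ((hlt.trans (Finset.dvd_prod_of_mem N hs)).mul_left _)
  rw [map_zsmul, zsmul_eq_mul, norm_mul, h4, one_mul] at h3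
  exact h3

lemma ftcase {A : Type*} [CommRing A] [Nontrivial A] [Algebra ℚ A] [Algebra.FiniteType ℚ A] (S : Finset A) :
    ∃ (p : ℕ) (_ : Fact p.Prime) (g : A →+* ℚ_[p]), ∀ s ∈ S, ‖g s‖ ≤ 1 := by
  classical
  obtain ⟨M, hM⟩ := Ideal.exists_maximal A
  have hft : Algebra.FiniteType ℚ (A ⧸ M) := Algebra.FiniteType.of_surjective (Ideal.Quotient.mkₐ ℚ M) (Ideal.Quotient.mkₐ_surjective ℚ M)
  let _ : Field (A ⧸ M) := Ideal.Quotient.field M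
  have : Module.Finite ℚ (A ⧸ M) := finite_of_finite_type_of_isJacobsonRing _ _
  obtain ⟨p, hp, g, hg⟩ := numfield (S.image (Ideal.Quotient.mk M))
  exact ⟨p, hp, g.comp (Ideal.Quotient.mk M), fun s hs => hg _ (Finset.mem_image_of_mem _ hs)⟩

lemma cassels {K : Type*} [Field K] [CharZero K] (S : Finset K) :
    ∃ (p : ℕ) (_ : Fact p.Prime), Nonempty (Algebra.adjoin ℤ (S : Set K) →+* ℤ_[p]) := by
  classical
  set A := Algebra.adjoin ℚ (S : Set K) with hA
  have hft : Algebra.FiniteType ℚ A := by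
    rw [← Subalgebra.fg_iff_finiteType]
    exact ⟨S, rfl⟩
  have hSA : ∀ s ∈ S, s ∈ A := fun s hs => Algebra.subset_adjoin hs
  have hle : ∀ s ∈ Algebra.adjoin ℤ (S : Set K), s ∈ A := by
    intro s hs
    have : Algebra.adjoin ℤ (S : Set K) ≤ A.restrictScalars ℤ := Algebra.adjoin_le (fun s hs => hSA s hs)
    exact this hs
  let S' : Finset A := S.attach.image (fun s => ⟨s.1, hSA s.1 s.2⟩)
  obtain ⟨p, hp, g, hg⟩ := ftcase S'
  refine ⟨p, hp, ⟨?_⟩⟩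
  let i : Algebra.adjoin ℤ (S : Set K) →+* A :=
    { toFun := fun s => ⟨s.1, hle s.1 s.2⟩
      map_one' := rfl
      map_mul' := fun _ _ => rfl
      map_zero' := rfl
      map_add' := fun _ _ => rfl }
  let h : Algebra.adjoin ℤ (S : Set K) →+* ℚ_[p] := g.comp i
  have hh : ∀ r, ‖h r‖ ≤ 1 := by
    rintro ⟨r, hr⟩
    induction hr using Algebra.adjoin_induction with
    | mem s hs =>
      exact hg _ (Finset.mem_image.2 ⟨⟨s, hs⟩, Finset.mem_attach _ _, rfl⟩)
    | algebraMap c =>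
      have : h ⟨algebraMap ℤ K c, Subalgebra.algebraMap_mem _ c⟩ = (c : ℚ_[p]) := by
        have e : (⟨algebraMap ℤ K c, Subalgebra.algebraMap_mem _ c⟩ : Algebra.adjoin ℤ (S : Set K)) = (c : Algebra.adjoin ℤ (S : Set K)) := by
          apply Subtype.ext; simp
        rw [e, map_intCast]
      rw [this]
      exact Padic.norm_int_le_one c
    | add a b ha hb h1 h2 =>
      have : h ⟨a + b, add_mem ha hb⟩ = h ⟨a, ha⟩ + h ⟨b, hb⟩ := by rw [← map_add]; rfl
      rw [this]
      exact (Padic.nonarchimedean _ _).trans (max_le h1 h2)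
    | mul a b ha hb h1 h2 =>
      have : h ⟨a * b, mul_mem ha hb⟩ = h ⟨a, ha⟩ * h ⟨b, hb⟩ := by rw [← map_mul]; rfl
      rw [this, norm_mul]
      exact mul_le_one₀ h1 (norm_nonneg _) h2
  exact
    { toFun := fun r => ⟨h r, hh r⟩
      map_one' := Subtype.ext (map_one h)
      map_mul' := fun a b => Subtype.ext (map_mul h a b)
      map_zero' := Subtype.ext (map_zero h)
      map_add' := fun a b => Subtype.ext (map_add h a b) }
end WA

/-- **Theorem 1.3.** Let `x, y` be elements of the Weyl algebra `A₁` over a field `K` of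
characteristic zero with `[y,x] = 1`, and let `A₁' = K⟨x,y⟩` be the subalgebra generated
by `x` and `y`. Then `Frac(A₁') ∩ A₁ = A₁'` inside `Frac(A₁)`.

Since `A₁'` is an Ore domain, every element of its skew field of fractions `Frac(A₁')`
is a left fraction `p⁻¹ * q` with `p, q ∈ A₁'`, `p ≠ 0`; thus an element `a` of `A₁` lies
in `Frac(A₁') ∩ A₁` if and only if `p * a = q` for some `p, q ∈ A₁'` with `p ≠ 0`. The
theorem states that this happens exactly when `a ∈ A₁'`. -/
theorem frac_adjoin_inter_weyl (K : Type*) [Field K] [CharZero K]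
    (x y : WeylAlgebra K) (hxy : y * x - x * y = 1) (a : WeylAlgebra K) :
    (∃ p ∈ Algebra.adjoin K ({x, y} : Set (WeylAlgebra K)),
      ∃ q ∈ Algebra.adjoin K ({x, y} : Set (WeylAlgebra K)), p ≠ 0 ∧ p * a = q)
    ↔ a ∈ Algebra.adjoin K ({x, y} : Set (WeylAlgebra K)) := by
  have h : y * x = x * y + 1 := by rw [← hxy]; abel
  constructor
  · rintro ⟨p, hp, q, hq, hne, hpq⟩
    rw [← WA.lift_range (h := h)] at hp hq ⊢
    obtain ⟨P, rfl⟩ := hp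
    obtain ⟨Q, rfl⟩ := hq
    refine WA.final WA.cassels h P Q a ?_ hpq
    rintro rfl
    exact hne (map_zero _)
  · intro ha
    exact ⟨1, one_mem _, a, ha, one_ne_zero, one_mul a⟩
end

section
/- Let C be a maximal commutative subalgebra of the first Weyl algebra A₁ over a field K of characteristic zero and let δ be a nonzero K-derivation of C. The following are equivalent: (a) δ is a locally nilpotent derivation of C; (b) there exist an element c ∈ C∖ker(δ) and an integer n ≥ 2 such that δⁿ(c) = 0; (c) C = K[t] is a polynomial algebra in one variable t ∈ C and δ = d/dt. -/
open Polynomial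

structure DegFun (K : Type*) [Field K] (B : Type*) [CommRing B] [Algebra K B] (deg : B → ℕ) : Prop where
  nz : ∀ a b : B, a ≠ 0 → b ≠ 0 → a * b ≠ 0
  mul : ∀ a b : B, a ≠ 0 → b ≠ 0 → deg (a * b) = deg a + deg b
  add : ∀ a b : B, deg (a + b) ≤ max (deg a) (deg b)
  scal : ∀ k : K, deg (algebraMap K B k) = 0
  scal' : ∀ a, deg a = 0 → ∃ k : K, a = algebraMap K B k
  gr : ∀ a b, 0 < deg a → deg a = deg b → ∃ k : K, deg (a - algebraMap K B k * b) < deg a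

set_option linter.unusedSectionVars false
namespace DegFun
variable {K : Type*} [Field K] [CharZero K] {B : Type*} [CommRing B] [Algebra K B] {deg : B → ℕ}

theorem zero (h : DegFun K B deg) : deg 0 = 0 := by
  have := h.scal 0; simpa using this

theorem mul_le (h : DegFun K B deg) (a b : B) : deg (a * b) ≤ deg a + deg b := by
  by_cases ha : a = 0
  · simp [ha, h.zero]
  by_cases hb : b = 0
  · simp [hb, h.zero]
  exact (h.mul a b ha hb).le

theorem ne_zero (h : DegFun K B deg) {a : B} (ha : 0 < deg a) : a ≠ 0 := by
  rintro rfl; rw [h.zero] at ha; omega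

theorem pow_ne (h : DegFun K B deg) {a : B} (ha : 0 < deg a) (n : ℕ) :
    a ^ n ≠ 0 ∧ deg (a ^ n) = n * deg a := by
  have h0 := h.ne_zero ha
  have h1 : (1 : B) ≠ 0 := fun h1 => h0 (by rw [← mul_one a, h1, mul_zero])
  induction n with
  | zero => 
    refine ⟨by simpa using h1, ?_⟩
    have := h.scal 1
    simpa using this
  | succ n ih =>
    rw [pow_succ]
    refine ⟨h.nz _ _ ih.1 h0, ?_⟩
    rw [h.mul _ _ ih.1 h0, ih.2]; ring

variable {δ : B →ₗ[K] B}

theorem d_scal (hL : ∀ a b : B, δ (a * b) = a * δ b + δ a * b) (k : K) :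
    δ (algebraMap K B k) = 0 := by
  have h1 := hL 1 1
  simp at h1
  rw [Algebra.algebraMap_eq_smul_one, map_smul, h1, smul_zero]

theorem d_scal_mul (k : K) (b : B) :
    δ (algebraMap K B k * b) = algebraMap K B k * δ b := by
  rw [← Algebra.smul_def, map_smul, Algebra.smul_def]

theorem d_pow (hL : ∀ a b : B, δ (a * b) = a * δ b + δ a * b) (a : B) (n : ℕ) :
    δ (a ^ (n + 1)) = (n + 1 : ℕ) * a ^ n * δ a := by
  induction n with
  | zero => simp
  | succ n ih => rw [pow_succ, hL, ih]; push_cast; ring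

theorem exists_bound (h : DegFun K B deg) (hL : ∀ a b : B, δ (a * b) = a * δ b + δ a * b)
    (t : B) (μ : K) (ht : 0 < deg t) (hμ : δ t = algebraMap K B μ) :
    ∃ N : ℕ, ∀ c, deg (δ c) ≤ deg c + N := by
  have hrep : ∀ r : ℕ, ∃ x : B, ∀ c : B, c ≠ 0 → deg c % deg t = r →
      x ≠ 0 ∧ deg x % deg t = r ∧ deg x ≤ deg c := by
    intro r
    by_cases hne : ({c : B | c ≠ 0 ∧ deg c % deg t = r} : Set B).Nonempty
    · obtain ⟨x, hx, hm⟩ := WellFounded.has_min (measure deg).wf _ hne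
      refine ⟨x, fun c hc hcr => ⟨hx.1, hx.2, ?_⟩⟩
      have := hm c ⟨hc, hcr⟩
      exact not_lt.mp this
    · refine ⟨0, fun c hc hcr => (hne ⟨c, hc, hcr⟩).elim⟩
  choose x hx using hrep
  refine ⟨(Finset.range (deg t)).sup (fun r => deg (δ (x r))), ?_⟩
  set N := (Finset.range (deg t)).sup (fun r => deg (δ (x r))) with hN
  have hNle : ∀ r < deg t, deg (δ (x r)) ≤ N := fun r hr =>
    Finset.le_sup (f := fun r => deg (δ (x r))) (Finset.mem_range.mpr hr)
  intro c
  induction hm : deg c using Nat.strong_induction_on generalizing c with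
  | _ m ih =>
  subst hm
  rcases Nat.eq_zero_or_pos (deg c) with h0 | hpos
  · obtain ⟨k, rfl⟩ := h.scal' c h0
    rw [d_scal hL, h.zero]; omega
  obtain ⟨hx0, hxr, hxle⟩ := hx _ c (h.ne_zero hpos) rfl
  have hNr := hNle (deg c % deg t) (Nat.mod_lt _ ht)
  set y := x (deg c % deg t)
  obtain ⟨k, hk⟩ : ∃ k, deg c = deg y + k * deg t := by
    have := (Nat.modEq_iff_dvd' hxle).mp hxr
    obtain ⟨k, hk⟩ := this
    exact ⟨k, by rw [mul_comm]; omega⟩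
  have hp := h.pow_ne ht k
  have hdeg : deg c = deg (y * t ^ k) := by rw [h.mul _ _ hx0 hp.1, hp.2, hk]
  obtain ⟨l, hl⟩ := h.gr c _ hpos hdeg
  have e1 := ih _ hl (c - algebraMap K B l * (y * t ^ k)) rfl
  have e2 : deg (δ (y * t ^ k)) ≤ deg c + N := by
    rw [hL]
    refine (h.add _ _).trans (max_le ?_ ?_)
    · rcases k with _ | k
      · have : δ (1 : B) = 0 := by simpa using d_scal hL (1 : K)
        simp [this, h.zero]
      · rw [d_pow hL, hμ]
        have hp' := h.pow_ne ht k
        have : y * (((k + 1 : ℕ) : B) * t ^ k * algebraMap K B μ) =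
          algebraMap K B ((k + 1 : ℕ) * μ) * (y * t ^ k) := by
          rw [map_mul, map_natCast]; ring
        rw [this]
        refine (h.mul_le _ _).trans ?_
        rw [h.scal, h.mul _ _ hx0 hp'.1, hp'.2, hk]
        nlinarith
    · refine (h.mul_le _ _).trans ?_
      rw [hp.2]; omega
  have e3 : δ c = δ (c - algebraMap K B l * (y * t ^ k)) + algebraMap K B l * δ (y * t ^ k) := by
    rw [map_sub, d_scal_mul]; ring
  rw [e3]
  refine (h.add _ _).trans (max_le (by omega) ((h.mul_le _ _).trans ?_))
  rw [h.scal]; omega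

def Bd (deg : B → ℕ) (δ : B →ₗ[K] B) (L : ℤ) : Prop :=
  ∀ c, δ c ≠ 0 → (deg (δ c) : ℤ) ≤ deg c + L

def Sm (deg : B → ℕ) (b : B) (L : ℤ) : Prop := b ≠ 0 → (deg b : ℤ) < L

theorem Sm.add (h : DegFun K B deg) {a b : B} {L : ℤ} (ha : Sm deg a L) (hb : Sm deg b L) :
    Sm deg (a + b) L := by
  intro hab
  by_cases h0 : a = 0
  · subst h0; rw [zero_add] at *; exact hb hab
  by_cases h1 : b = 0
  · subst h1; rw [add_zero] at *; exact ha hab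
  have := h.add a b
  have := ha h0
  have := hb h1
  omega

theorem Bd.step (h : DegFun K B deg) (hL : ∀ a b : B, δ (a * b) = a * δ b + δ a * b)
    (t : B) (μ : K) (ht : 0 < deg t) (hμ : δ t = algebraMap K B μ) (L : ℤ)
    (hLe : μ = 0 ∨ -(deg t : ℤ) ≤ L) (hB : Bd deg δ (L + 1)) : Bd deg δ L := by
  intro c hc
  by_contra hlt
  have heq : (deg (δ c) : ℤ) = deg c + (L + 1) := le_antisymm (hB c hc) (by omega)
  have hpos : 0 < deg c := by
    rcases Nat.eq_zero_or_pos (deg c) with h0 | hpos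
    · obtain ⟨k, rfl⟩ := h.scal' c h0
      exact (hc (d_scal hL k)).elim
    · exact hpos
  obtain ⟨e, he⟩ : ∃ e, deg t = e + 1 := ⟨deg t - 1, by omega⟩
  obtain ⟨m, hm⟩ : ∃ m, deg c = m + 1 := ⟨deg c - 1, by omega⟩
  have hce := h.pow_ne hpos (e + 1)
  have htm := h.pow_ne ht (m + 1)
  obtain ⟨k, hk⟩ := h.gr (c ^ (e + 1)) (t ^ (m + 1)) (by rw [hce.2]; positivity)
    (by rw [hce.2, htm.2, hm, he]; ring)
  set l := c ^ (e + 1) - algebraMap K B k * t ^ (m + 1) with hl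
  have key : algebraMap K B ((e + 1 : ℕ) : K) * (c ^ e * δ c) =
      algebraMap K B (k * (m + 1 : ℕ) * μ) * t ^ m + δ l := by
    rw [hl, map_sub, d_scal_mul, d_pow hL, d_pow hL, hμ]
    simp only [map_mul, map_natCast]
    ring
  have hone : (algebraMap K B ((e + 1 : ℕ) : K)) ≠ 0 := by
    intro h0
    have : c ^ e * δ c = algebraMap K B (((e + 1 : ℕ) : K)⁻¹ * ((e + 1 : ℕ) : K)) * (c ^ e * δ c) := by
      rw [inv_mul_cancel₀ (Nat.cast_ne_zero.mpr (Nat.succ_ne_zero e))]; simp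
    rw [map_mul, h0, mul_zero, zero_mul] at this
    exact h.nz _ _ (h.pow_ne hpos e).1 hc this
  have hne := h.nz _ _ (h.pow_ne hpos e).1 hc
  have hne2 := h.nz _ _ hone hne
  have hS : Sm deg (algebraMap K B ((e + 1 : ℕ) : K) * (c ^ e * δ c))
      ((deg c * deg t : ℕ) + (L + 1)) := by
    rw [key]
    refine Sm.add h ?_ ?_
    · rcases hLe with h0 | hle
      · intro hh; simp [h0] at hh
      · intro _
        have h1 := h.mul_le (algebraMap K B (k * (m + 1 : ℕ) * μ)) (t ^ m)
        rw [h.scal, (h.pow_ne ht m).2] at h1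
        have h2 : deg c * deg t = m * deg t + deg t := by rw [hm]; ring
        rw [h2]; push_cast; zify at h1; linarith
    · intro hh
      have h1 := hB _ hh
      rw [hce.2] at hk
      have h2 : deg l < deg c * deg t := by rw [he, mul_comm]; exact hk
      zify at h2
      push_cast
      linarith
  have := hS hne2
  rw [h.mul _ _ hone hne, h.scal, h.mul _ _ (h.pow_ne hpos e).1 hc, (h.pow_ne hpos e).2] at this
  push_cast at this
  rw [heq, he] at this
  push_cast at this
  nlinarith

theorem Bd.all (h : DegFun K B deg) (hL : ∀ a b : B, δ (a * b) = a * δ b + δ a * b)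
    (t : B) (μ : K) (ht : 0 < deg t) (hμ : δ t = algebraMap K B μ) (L : ℤ)
    (hLe : μ = 0 ∨ -(deg t : ℤ) ≤ L) : Bd deg δ L := by
  obtain ⟨N, hN⟩ := h.exists_bound hL t μ ht hμ
  have hm : ∀ L L' : ℤ, L ≤ L' → Bd deg δ L → Bd deg δ L' := by
    intro L L' hl hb c hc
    have := hb c hc
    omega
  have key : ∀ k : ℕ, ∀ L : ℤ, (N : ℤ) - k ≤ L → (μ = 0 ∨ -(deg t : ℤ) ≤ L) → Bd deg δ L := by
    intro k
    induction k with
    | zero =>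
      intro L h1 _
      refine hm N L (by simpa using h1) ?_
      intro c _
      exact_mod_cast hN c
    | succ k ih =>
      intro L h1 h2
      refine Bd.step h hL t μ ht hμ L h2 (ih (L + 1) (by push_cast at h1; omega) ?_)
      rcases h2 with h2 | h2
      · exact Or.inl h2
      · right; omega
  exact key (N - L).toNat L (by omega) hLe

theorem ker_scal (h : DegFun K B deg) (hL : ∀ a b : B, δ (a * b) = a * δ b + δ a * b)
    (hδ : δ ≠ 0) (v : B) (hv : δ v = 0) : ∃ k, v = algebraMap K B k := by
  apply h.scal'
  by_contra hne
  apply hδ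
  ext c
  by_contra hc
  have := Bd.all h hL v 0 (Nat.pos_of_ne_zero hne) (by simpa using hv) (-(deg c : ℤ) - 1) (Or.inl rfl) c hc
  omega

theorem d_aeval (hL : ∀ a b : B, δ (a * b) = a * δ b + δ a * b) (t : B) (ht : δ t = 1) (p : K[X]) :
    δ (aeval t p) = aeval t (derivative p) := by
  induction p using Polynomial.induction_on' with
  | add p q hp hq => simp [hp, hq]
  | monomial n a =>
    rw [aeval_monomial, d_scal_mul, derivative_monomial, aeval_monomial]
    rcases n with _ | n
    · have : δ (1 : B) = 0 := by simpa using d_scal hL (1 : K)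
      simp [this]
    · rw [d_pow hL, ht]; simp; ring

theorem exists_anti (p : K[X]) : ∃ q : K[X], derivative q = p := by
  induction p using Polynomial.induction_on' with
  | add p q hp hq =>
    obtain ⟨a, rfl⟩ := hp
    obtain ⟨b, rfl⟩ := hq
    exact ⟨a + b, by simp⟩
  | monomial n a =>
    refine ⟨monomial (n + 1) (a / (n + 1)), ?_⟩
    rw [derivative_monomial]
    have : (n : K) + 1 ≠ 0 := Nat.cast_add_one_ne_zero n
    simp [this]

theorem main (h : DegFun K B deg) (hL : ∀ a b : B, δ (a * b) = a * δ b + δ a * b)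
    (hδ : δ ≠ 0) (hb : ∃ c : B, δ c ≠ 0 ∧ ∃ n : ℕ, 2 ≤ n ∧ (δ ^ n) c = 0) :
    ∃ t : B, (∀ c, ∃ p : K[X], c = aeval t p) ∧ δ t = 1 := by
  obtain ⟨u, hu1, hu2⟩ : ∃ u, δ u ≠ 0 ∧ δ (δ u) = 0 := by
    obtain ⟨c, hc, n, -, hn⟩ := hb
    by_contra! hcon
    have : ∀ n, (δ ^ (n + 1)) c ≠ 0 := by
      intro n
      induction n with
      | zero => simpa using hc
      | succ n ih =>
        rw [pow_succ' δ (n + 1), Module.End.mul_apply]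
        rw [pow_succ' δ n, Module.End.mul_apply] at ih ⊢
        exact hcon _ ih
    refine this n ?_
    rw [pow_succ', Module.End.mul_apply, hn, map_zero]
  obtain ⟨μ, hμ⟩ := h.ker_scal hL hδ _ hu2
  have hμ0 : μ ≠ 0 := by rintro rfl; simp at hμ; exact hu1 hμ
  have ht1 : δ (algebraMap K B μ⁻¹ * u) = 1 := by
    rw [d_scal_mul, hμ, ← map_mul, inv_mul_cancel₀ hμ0, map_one]
  set t := algebraMap K B μ⁻¹ * u
  refine ⟨t, ?_, ht1⟩
  have hone : (1 : B) ≠ 0 := fun h1 => hu1 (by rw [← mul_one (δ u), h1, mul_zero])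
  have htpos : 0 < deg t := by
    rcases Nat.eq_zero_or_pos (deg t) with h0 | hpos
    · obtain ⟨k, hk⟩ := h.scal' _ h0
      rw [hk, d_scal hL] at ht1
      exact (hone ht1.symm).elim
    · exact hpos
  have hbd := Bd.all h hL t 1 htpos (by simpa using ht1) (-(deg t : ℤ)) (Or.inr le_rfl)
  have hker : ∀ c, δ c = 0 → ∃ p : K[X], c = aeval t p := by
    intro c hc
    obtain ⟨k, hk⟩ := h.ker_scal hL hδ _ hc
    exact ⟨C k, by simp [hk]⟩
  intro c
  induction hm : deg c using Nat.strong_induction_on generalizing c with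
  | _ m ih =>
  subst hm
  by_cases hc : δ c = 0
  · exact hker c hc
  have := hbd c hc
  obtain ⟨p, hp⟩ := ih _ (by omega) (δ c) rfl
  obtain ⟨q, rfl⟩ := exists_anti p
  obtain ⟨r, hr⟩ := hker (c - aeval t q) (by rw [map_sub, d_aeval hL t ht1, hp, sub_self])
  exact ⟨r + q, by rw [map_add, ← hr]; ring⟩

theorem transc (hL : ∀ a b : B, δ (a * b) = a * δ b + δ a * b) (hδ : δ ≠ 0)
    (t : B) (ht : δ t = 1) : Transcendental K t := by
  have : Nontrivial B := by
    by_contra hn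
    rw [not_nontrivial_iff_subsingleton] at hn
    exact hδ (by ext; exact Subsingleton.elim _ _)
  rw [transcendental_iff]
  intro p hp
  induction hm : p.natDegree using Nat.strong_induction_on generalizing p with
  | _ m ih =>
  subst hm
  have h1 : p.natDegree = 0 := by
    by_contra hne
    have := ih _ (natDegree_derivative_lt hne) (derivative p)
      (by rw [← d_aeval hL t ht, hp, map_zero]) rfl
    exact hne (derivative_eq_zero.mp this)
  rw [natDegree_eq_zero] at h1
  obtain ⟨k, rfl⟩ := h1
  simp at hp
  simp [hp]

theorem c_a (hL : ∀ a b : B, δ (a * b) = a * δ b + δ a * b)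
    (t : B) (ht : δ t = 1) (p : K[X]) : ∃ n : ℕ, 1 ≤ n ∧ (δ ^ n) (aeval t p) = 0 := by
  refine ⟨p.natDegree + 1, by omega, ?_⟩
  have : ∀ n, (δ ^ n) (aeval t p) = aeval t (derivative^[n] p) := by
    intro n
    induction n with
    | zero => simp
    | succ n ih => rw [pow_succ', Module.End.mul_apply, ih, d_aeval hL t ht, Function.iterate_succ_apply']
  rw [this, iterate_derivative_eq_zero (by omega), map_zero]

end DegFun

namespace WA
variable {K : Type*} [Field K]

noncomputable def D : K[X][X] →ₗ[K] K[X][X] where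
  toFun w := ∑ i ∈ Finset.range (w.natDegree + 1), monomial i (derivative (w.coeff i))
  map_add' a b := by
    have key : ∀ (w : K[X][X]) (i : ℕ), (∑ i ∈ Finset.range (w.natDegree + 1), monomial i (derivative (w.coeff i))).coeff i = derivative (w.coeff i) := by
      intro w i
      simp only [finsetSum_coeff, coeff_monomial]
      rw [Finset.sum_ite_eq']
      split_ifs with hi
      · rfl
      · rw [coeff_eq_zero_of_natDegree_lt (by simpa using hi), map_zero]
    refine Polynomial.ext fun i => ?_
    rw [coeff_add, key, key, key, coeff_add, map_add]
  map_smul' k a := by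
    have key : ∀ (w : K[X][X]) (i : ℕ), (∑ i ∈ Finset.range (w.natDegree + 1), monomial i (derivative (w.coeff i))).coeff i = derivative (w.coeff i) := by
      intro w i
      simp only [finsetSum_coeff, coeff_monomial]
      rw [Finset.sum_ite_eq']
      split_ifs with hi
      · rfl
      · rw [coeff_eq_zero_of_natDegree_lt (by simpa using hi), map_zero]
    refine Polynomial.ext fun i => ?_
    rw [RingHom.id_apply, coeff_smul, key, key, coeff_smul, derivative_smul]

theorem D_coeff (w : K[X][X]) (i : ℕ) : (D w).coeff i = derivative (w.coeff i) := by
  simp only [D, LinearMap.coe_mk, AddHom.coe_mk, finsetSum_coeff, coeff_monomial]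
  rw [Finset.sum_ite_eq']
  split_ifs with hi
  · rfl
  · rw [coeff_eq_zero_of_natDegree_lt (by simpa using hi), map_zero]

theorem D_nat (w : K[X][X]) {n : ℕ} (h : w.natDegree ≤ n) : (D w).natDegree ≤ n := by
  rw [natDegree_le_iff_coeff_eq_zero]
  intro i hi
  rw [D_coeff, coeff_eq_zero_of_natDegree_lt (by omega), map_zero]

theorem D_X (w : K[X][X]) : D (X * w) = X * D w := by
  refine Polynomial.ext fun i => ?_
  rcases i with _ | i
  · simp [D_coeff]
  · simp [D_coeff]

theorem D_Xpow (j : ℕ) (w : K[X][X]) : D (X ^ j * w) = X ^ j * D w := by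
  induction j with
  | zero => simp
  | succ j ih => rw [pow_succ', mul_assoc, D_X, ih, mul_assoc]

theorem D_C (p : K[X]) (w : K[X][X]) : D (C p * w) = C p * D w + C (derivative p) * w := by
  refine Polynomial.ext fun i => ?_
  simp [D_coeff]; ring

noncomputable def E : K[X][X] →ₗ[K] K[X][X] := LinearMap.mulLeft K X + D

theorem E_apply (w : K[X][X]) : E w = X * w + D w := rfl

noncomputable def Phi : WeylAlgebra K →ₐ[K] Module.End K K[X][X] :=
  RingQuot.liftAlgHom K ⟨FreeAlgebra.lift K ![LinearMap.mulLeft K (C X), E], by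
    rintro a b ⟨rfl, rfl⟩
    refine LinearMap.ext fun w => ?_
    simp [E_apply, D_C, Module.End.mul_apply]
    ring⟩

noncomputable def x : WeylAlgebra K := RingQuot.mkAlgHom K (weylRel K) (FreeAlgebra.ι K 0)
noncomputable def y : WeylAlgebra K := RingQuot.mkAlgHom K (weylRel K) (FreeAlgebra.ι K 1)

theorem yx : (y : WeylAlgebra K) * x = x * y + 1 := by
  have := RingQuot.mkAlgHom_rel K (s := weylRel K) ⟨rfl, rfl⟩
  simpa [x, y] using this

theorem Phi_x (w : K[X][X]) : Phi x w = C X * w := by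
  simp [Phi, x]

theorem Phi_y (w : K[X][X]) : Phi y w = E w := by
  simp [Phi, y]

theorem y_aeval (p : K[X]) :
    (y : WeylAlgebra K) * aeval x p = aeval x p * y + aeval x (derivative p) := by
  induction p using Polynomial.induction_on with
  | C a => simp [Algebra.commutes]
  | add p q hp hq => rw [map_add, mul_add, hp, hq, map_add, map_add, add_mul]; abel
  | monomial n a ih =>
    rw [pow_succ, ← mul_assoc]
    generalize C a * X ^ n = q at ih
    rw [derivative_mul, map_add, map_mul, map_mul, derivative_X, mul_one, aeval_X, ← mul_assoc, ih,
      add_mul, mul_assoc _ y x, yx]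
    noncomm_ring

noncomputable def psi (w : K[X][X]) : WeylAlgebra K :=
  eval₂ (aeval x : K[X] →ₐ[K] WeylAlgebra K).toRingHom y w

theorem psi_add (a b : K[X][X]) : psi (a + b) = psi a + psi b := eval₂_add _ _

theorem psi_mon (n : ℕ) (p : K[X]) : psi (monomial n p) = aeval x p * y ^ n := by
  rw [psi, eval₂_monomial]; rfl

theorem psi_x (w : K[X][X]) : psi (C X * w) = x * psi w := by
  induction w using Polynomial.induction_on' with
  | add p q hp hq => rw [mul_add, psi_add, hp, hq, psi_add, mul_add]
  | monomial n p => rw [C_mul_monomial, psi_mon, psi_mon, map_mul, aeval_X, mul_assoc]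

theorem psi_y (w : K[X][X]) : psi (E w) = y * psi w := by
  induction w using Polynomial.induction_on' with
  | add p q hp hq => rw [map_add, psi_add, hp, hq, psi_add, mul_add]
  | monomial n p =>
    have : E (monomial n p) = monomial (n + 1) p + monomial n (derivative p) := by
      rw [E_apply, X_mul_monomial]
      congr 1
      refine Polynomial.ext fun i => ?_
      rw [D_coeff, coeff_monomial, coeff_monomial]
      split_ifs <;> simp
    rw [this, psi_add, psi_mon, psi_mon, psi_mon, ← mul_assoc, y_aeval, add_mul, mul_assoc _ y, pow_succ']

theorem psi_smul (k : K) (w : K[X][X]) : psi (k • w) = k • psi w := by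
  induction w using Polynomial.induction_on' with
  | add p q hp hq => rw [smul_add, psi_add, hp, hq, psi_add, smul_add]
  | monomial n p => rw [smul_monomial, psi_mon, psi_mon, map_smul, smul_mul_assoc]

theorem psi_Phi (a : WeylAlgebra K) (w : K[X][X]) : psi (Phi a w) = a * psi w := by
  obtain ⟨b, rfl⟩ := RingQuot.mkAlgHom_surjective K (weylRel K) a
  induction b using FreeAlgebra.induction generalizing w with
  | grade0 k => rw [AlgHom.commutes, AlgHom.commutes, Module.algebraMap_end_apply, psi_smul, Algebra.smul_def]
  | grade1 i =>
    fin_cases i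
    · exact (congrArg psi (Phi_x w)).trans (psi_x w)
    · exact (congrArg psi (Phi_y w)).trans (psi_y w)
  | mul a b ha hb => rw [map_mul, map_mul, Module.End.mul_apply, ha, hb, mul_assoc]
  | add a b ha hb => rw [map_add, map_add, LinearMap.add_apply, psi_add, ha, hb, add_mul]

noncomputable def phi : WeylAlgebra K →ₗ[K] K[X][X] where
  toFun a := Phi a 1
  map_add' a b := by simp
  map_smul' k a := by simp

theorem phi_apply (a : WeylAlgebra K) : phi a = Phi a 1 := rfl

theorem psi_phi (a : WeylAlgebra K) : psi (phi a) = a := by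
  rw [phi_apply, psi_Phi]
  have : psi (1 : K[X][X]) = 1 := by rw [psi, eval₂_one]
  rw [this, mul_one]

theorem phi_inj {a b : WeylAlgebra K} (h : phi a = phi b) : a = b := by
  rw [← psi_phi a, h, psi_phi]

theorem phi_mul (a b : WeylAlgebra K) : phi (a * b) = Phi (psi (phi a)) (phi b) := by
  rw [psi_phi, phi_apply, map_mul]; rfl

theorem phi_scal (k : K) : phi (algebraMap K (WeylAlgebra K) k) = C (C k) := by
  rw [phi_apply, AlgHom.commutes, Module.algebraMap_end_apply, Algebra.smul_def, mul_one]; rfl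

theorem Phi_aeval (p : K[X]) (w : K[X][X]) : Phi (aeval x p) w = C p * w := by
  induction p using Polynomial.induction_on generalizing w with
  | C a =>
    rw [aeval_C, AlgHom.commutes, Module.algebraMap_end_apply, Algebra.smul_def]; rfl
  | add p q hp hq => simp [hp, hq, add_mul]
  | monomial n a ih =>
    rw [pow_succ, ← mul_assoc, map_mul, map_mul, Module.End.mul_apply, ih, aeval_X, Phi_x]
    simp only [map_mul]; ring

theorem Phi_ypow (j : ℕ) (u : K[X][X]) (m : ℕ) (hu : u.natDegree ≤ m) (i : ℕ) (hi : j + m ≤ i + 1) :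
    (Phi (y ^ j) u - X ^ j * u - derivative (X ^ j) * D u).coeff i = 0 := by
  induction j generalizing i with
  | zero => simp
  | succ j ih =>
    have e : Phi (y ^ (j + 1)) u - X ^ (j + 1) * u - derivative (X ^ (j + 1)) * D u
      = X * (Phi (y ^ j) u - X ^ j * u - derivative (X ^ j) * D u)
        + D (Phi (y ^ j) u - X ^ j * u - derivative (X ^ j) * D u)
        + derivative (X ^ j) * D (D u) := by
      have e2 : D (derivative (X ^ j) * D u) = derivative (X ^ j) * D (D u) := by
        rcases j with _ | j
        · simp
        · rw [derivative_X_pow, mul_assoc, D_C, D_Xpow]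
          simp [mul_assoc]
      rw [map_sub, map_sub, e2, D_Xpow, pow_succ' y, map_mul, Module.End.mul_apply, Phi_y, E_apply,
        pow_succ', derivative_mul, derivative_X]
      ring
    rw [e, coeff_add, coeff_add, D_coeff, ih i (by omega), map_zero, add_zero]
    have h1 : (X * (Phi (y ^ j) u - X ^ j * u - derivative (X ^ j) * D u)).coeff i = 0 := by
      rcases i with _ | i
      · simp
      · rw [coeff_X_mul, ih i (by omega)]
    rw [h1, zero_add]
    rcases j with _ | j
    · simp
    · apply coeff_eq_zero_of_natDegree_lt
      refine lt_of_le_of_lt natDegree_mul_le (?_ : _ < i)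
      have h2 := natDegree_derivative_le (X ^ (j + 1) : K[X][X])
      rw [natDegree_X_pow] at h2
      have h3 := D_nat _ (D_nat u hu)
      omega

theorem star_coeff (w u : K[X][X]) (n m : ℕ) (hw : w.natDegree ≤ n) (hu : u.natDegree ≤ m) (i : ℕ)
    (hi : n + m ≤ i + 1) :
    (Phi (psi w) u - w * u - derivative w * D u).coeff i = 0 := by
  revert hw
  refine induction_with_natDegree_le
    (fun w => (Phi (psi w) u - w * u - derivative w * D u).coeff i = 0) n ?_ ?_ ?_ w
  · simp [psi]
  · intro j r _ hj
    have := Phi_ypow j u m hu i (by omega)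
    have e : Phi (psi (C r * X ^ j)) u - C r * X ^ j * u - derivative (C r * X ^ j) * D u
      = C r * (Phi (y ^ j) u - X ^ j * u - derivative (X ^ j) * D u) := by
      rw [C_mul_X_pow_eq_monomial, psi_mon, map_mul, Module.End.mul_apply, Phi_aeval,
        ← C_mul_X_pow_eq_monomial, derivative_C_mul]
      ring
    rw [e, coeff_C_mul, this, mul_zero]
  · intro f g _ _ hf hg
    have e : Phi (psi (f + g)) u - (f + g) * u - derivative (f + g) * D u
      = (Phi (psi f) u - f * u - derivative f * D u) + (Phi (psi g) u - g * u - derivative g * D u) := by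
      rw [psi_add, map_add, map_add, LinearMap.add_apply]; ring
    rw [e, coeff_add, hf, hg, add_zero]

theorem cdm {R : Type*} [CommRing R] (w u : R[X]) (n m : ℕ) (hw : w.natDegree ≤ n)
    (hu : u.natDegree ≤ m) (i : ℕ) (hi : i + 1 = n + m) :
    (derivative w * u).coeff i = n * w.coeff n * u.coeff m := by
  rcases n with _ | n
  · rw [natDegree_eq_zero.mp (Nat.le_zero.mp hw) |>.choose_spec.symm]; simp
  · obtain rfl : i = n + m := by omega
    rw [coeff_mul_add_eq_of_natDegree_le ((natDegree_derivative_le w).trans (by omega)) hu, coeff_derivative]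
    push_cast; ring

theorem cdm0 {R : Type*} [CommRing R] (w u : R[X]) (n m : ℕ) (hw : w.natDegree ≤ n)
    (hu : u.natDegree ≤ m) (i : ℕ) (hi : n + m ≤ i) :
    (derivative w * u).coeff i = 0 := by
  rcases n with _ | n
  · rw [natDegree_eq_zero.mp (Nat.le_zero.mp hw) |>.choose_spec.symm]; simp
  · apply coeff_eq_zero_of_natDegree_lt
    refine lt_of_le_of_lt natDegree_mul_le ?_
    have := natDegree_derivative_le w
    omega

theorem phi_mul_coeff (a b : WeylAlgebra K) (i : ℕ)
    (hi : (phi a).natDegree + (phi b).natDegree ≤ i) :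
    (phi (a * b)).coeff i = (phi a * phi b).coeff i := by
  have h1 := star_coeff (phi a) (phi b) _ _ le_rfl le_rfl i (by omega)
  rw [coeff_sub, coeff_sub, cdm0 _ _ _ _ le_rfl (D_nat _ le_rfl) i hi, ← phi_mul, sub_zero,
    sub_eq_zero] at h1
  exact h1

theorem phi_ne {a : WeylAlgebra K} (ha : a ≠ 0) : phi a ≠ 0 := fun h =>
  ha (phi_inj (by rw [h, map_zero]))

theorem phi_mul_nat (a b : WeylAlgebra K) (ha : a ≠ 0) (hb : b ≠ 0) :
    a * b ≠ 0 ∧ (phi (a * b)).natDegree = (phi a).natDegree + (phi b).natDegree := by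
  have ha' := phi_ne ha
  have hb' := phi_ne hb
  have h1 := phi_mul_coeff a b _ le_rfl
  rw [coeff_mul_degree_add_degree] at h1
  have h2 : (phi (a * b)).coeff ((phi a).natDegree + (phi b).natDegree) ≠ 0 := by
    rw [h1]
    exact mul_ne_zero (leadingCoeff_ne_zero.mpr ha') (leadingCoeff_ne_zero.mpr hb')
  refine ⟨?_, ?_⟩
  · intro h
    rw [h, map_zero, coeff_zero] at h2
    exact h2 rfl
  · refine natDegree_eq_of_le_of_coeff_ne_zero ?_ h2
    rw [natDegree_le_iff_coeff_eq_zero]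
    intro i hi
    rw [phi_mul_coeff a b i hi.le]
    exact coeff_eq_zero_of_natDegree_lt (lt_of_le_of_lt natDegree_mul_le hi)

theorem ray [CharZero K] (a b : WeylAlgebra K) (ha : a ≠ 0) (hb : b ≠ 0) (hab : a * b = b * a) :
    (phi a).natDegree * (phi b).leadingCoeff.natDegree =
      (phi b).natDegree * (phi a).leadingCoeff.natDegree := by
  rcases Nat.eq_zero_or_pos ((phi a).natDegree + (phi b).natDegree) with h0 | hpos
  · have h1 : (phi a).natDegree = 0 := by omega
    have h2 : (phi b).natDegree = 0 := by omega
    rw [h1, h2]; simp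
  obtain ⟨i, hi⟩ : ∃ i, i + 1 = (phi a).natDegree + (phi b).natDegree := ⟨_, Nat.sub_add_cancel hpos⟩
  have h1 := star_coeff (phi a) (phi b) _ _ le_rfl le_rfl i (by omega)
  have h2 := star_coeff (phi b) (phi a) _ _ le_rfl le_rfl i (by omega)
  rw [coeff_sub, coeff_sub, cdm _ _ _ _ le_rfl (D_nat _ le_rfl) i (by omega), ← phi_mul, D_coeff] at h1 h2
  rw [hab, mul_comm (phi a)] at h1
  simp only [coeff_natDegree] at h1 h2
  have ha' := leadingCoeff_ne_zero.mpr (phi_ne ha)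
  have hb' := leadingCoeff_ne_zero.mpr (phi_ne hb)
  set p := (phi a).leadingCoeff
  set q := (phi b).leadingCoeff
  set n := (phi a).natDegree
  set m := (phi b).natDegree
  have h3 : C (n : K) * (derivative q * p) = C (m : K) * (derivative p * q) := by
    simp only [map_natCast]
    linear_combination h2 - h1
  rcases Nat.eq_zero_or_pos (p.natDegree + q.natDegree) with h0 | hpos
  · have h1 : p.natDegree = 0 := by omega
    have h2 : q.natDegree = 0 := by omega
    rw [h1, h2]; simp
  obtain ⟨j, hj⟩ : ∃ i, i + 1 = p.natDegree + q.natDegree := ⟨_, Nat.sub_add_cancel hpos⟩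
  have h4 := congrArg (fun f => f.coeff j) h3
  simp only [coeff_C_mul] at h4
  rw [cdm _ _ _ _ le_rfl le_rfl j (by omega), cdm _ _ _ _ le_rfl le_rfl j (by omega)] at h4
  simp only [coeff_natDegree] at h4
  have hp := leadingCoeff_ne_zero.mpr ha'
  have hq := leadingCoeff_ne_zero.mpr hb'
  have h5 : ((n * q.natDegree : ℕ) : K) = ((m * p.natDegree : ℕ) : K) := by
    apply mul_right_cancel₀ (mul_ne_zero hp hq)
    push_cast
    linear_combination h4
  exact_mod_cast h5

theorem scal_of (a : WeylAlgebra K) (h1 : (phi a).natDegree = 0)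
    (h2 : ((phi a).coeff 0).natDegree = 0) : ∃ k : K, a = algebraMap K _ k := by
  refine ⟨((phi a).coeff 0).coeff 0, phi_inj ?_⟩
  rw [phi_scal, ← eq_C_of_natDegree_eq_zero h2, ← eq_C_of_natDegree_eq_zero h1]

theorem phi_sub_scal (a b : WeylAlgebra K) (k : K) :
    phi (a - algebraMap K _ k * b) = phi a - C (C k) * phi b := by
  rw [← Algebra.smul_def, map_sub, map_smul, Algebra.smul_def]; rfl

theorem exists_deg [CharZero K] (S : Subalgebra K (WeylAlgebra K))
    (hS : ∀ a ∈ S, ∀ b ∈ S, a * b = b * a) : ∃ deg : WeylAlgebra K → ℕ,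
    (∀ a ∈ S, ∀ b ∈ S, a ≠ 0 → b ≠ 0 → deg (a * b) = deg a + deg b) ∧
    (∀ a ∈ S, ∀ b ∈ S, deg (a + b) ≤ max (deg a) (deg b)) ∧
    (∀ k : K, deg (algebraMap K _ k) = 0) ∧
    (∀ a ∈ S, deg a = 0 → ∃ k : K, a = algebraMap K _ k) ∧
    (∀ a ∈ S, ∀ b ∈ S, 0 < deg a → deg a = deg b →
      ∃ k : K, deg (a - algebraMap K _ k * b) < deg a) := by
  by_cases hex : ∃ c ∈ S, 0 < (phi c).natDegree
  · obtain ⟨c, hc, hcpos⟩ := hex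
    have hc0 : c ≠ 0 := by rintro rfl; simp at hcpos
    refine ⟨fun a => (phi a).natDegree, ?_, ?_, ?_, ?_, ?_⟩
    · intro a _ b _ ha hb
      exact (phi_mul_nat a b ha hb).2
    · intro a _ b _
      simp only [map_add]
      exact natDegree_add_le _ _
    · intro k
      simp [phi_scal]
    · intro a ha h0
      by_cases ha0 : a = 0
      · exact ⟨0, by simp [ha0]⟩
      have h0 : (phi a).natDegree = 0 := h0
      have := ray c a hc0 ha0 (hS _ hc _ ha)
      rw [h0, zero_mul, leadingCoeff, h0] at this
      refine scal_of a h0 ?_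
      rcases Nat.mul_eq_zero.mp this with h | h
      · omega
      · exact h
    · intro a ha b hb hpos heq
      simp only at hpos heq ⊢
      have ha0 : a ≠ 0 := by rintro rfl; simp at hpos
      have hb0 : b ≠ 0 := by rintro rfl; simp at heq; omega
      have hpa := leadingCoeff_ne_zero.mpr (phi_ne ha0)
      have hpb := leadingCoeff_ne_zero.mpr (phi_ne hb0)
      have hr := ray a b ha0 hb0 (hS _ ha _ hb)
      rw [← heq] at hr
      have hd := Nat.eq_of_mul_eq_mul_left hpos hr
      set k := (phi a).leadingCoeff.leadingCoeff / (phi b).leadingCoeff.leadingCoeff with hk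
      refine ⟨k, ?_⟩
      set z := a - algebraMap K _ k * b with hz
      have hzS : z ∈ S := S.sub_mem ha (S.mul_mem (S.algebraMap_mem k) hb)
      have hzphi : phi z = phi a - C (C k) * phi b := phi_sub_scal a b k
      have hle : (phi z).natDegree ≤ (phi a).natDegree := by
        rw [hzphi]
        refine (natDegree_sub_le _ _).trans (max_le le_rfl ?_)
        rw [heq]
        exact natDegree_C_mul_le _ _
      refine lt_of_le_of_ne hle fun hze => ?_
      have hz0 : z ≠ 0 := by
        intro h; rw [h] at hze; simp at hze; omega
      have hr2 := ray a z ha0 hz0 (hS _ ha _ hzS)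
      rw [hze] at hr2
      have hd2 := Nat.eq_of_mul_eq_mul_left hpos hr2
      have hlz : (phi z).leadingCoeff = (phi a).leadingCoeff - C k * (phi b).leadingCoeff := by
        rw [leadingCoeff, hze, hzphi, coeff_sub, coeff_C_mul, leadingCoeff, leadingCoeff, heq]
      have h6 : (phi z).leadingCoeff.leadingCoeff = 0 := by
        rw [leadingCoeff, hd2, hlz, coeff_sub, coeff_C_mul, coeff_natDegree, ← hd, coeff_natDegree, hk,
          div_mul_cancel₀ _ (leadingCoeff_ne_zero.mpr hpb), sub_self]
      exact phi_ne hz0 (leadingCoeff_eq_zero.mp (leadingCoeff_eq_zero.mp h6))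
  · push Not at hex
    have h0 : ∀ a ∈ S, (phi a).natDegree = 0 := fun a ha => Nat.le_zero.mp (hex a ha)
    have hne : ∀ a ∈ S, a ≠ 0 → (phi a).coeff 0 ≠ 0 := by
      intro a ha hne h
      apply phi_ne hne
      rw [eq_C_of_natDegree_eq_zero (h0 a ha), h, map_zero]
    refine ⟨fun a => ((phi a).coeff 0).natDegree, ?_, ?_, ?_, ?_, ?_⟩
    · intro a ha b hb ha0 hb0
      simp only
      rw [phi_mul_coeff a b 0 (by rw [h0 a ha, h0 b hb]), mul_coeff_zero,
        natDegree_mul (hne a ha ha0) (hne b hb hb0)]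
    · intro a _ b _
      simp only [map_add, coeff_add]
      exact natDegree_add_le _ _
    · intro k
      simp [phi_scal]
    · intro a ha h1
      exact scal_of a (h0 a ha) h1
    · intro a ha b hb hpos heq
      simp only at hpos heq ⊢
      refine ⟨((phi a).coeff 0).leadingCoeff / ((phi b).coeff 0).leadingCoeff, ?_⟩
      rw [phi_sub_scal, coeff_sub, coeff_C_mul]
      set p := (phi a).coeff 0
      set q := (phi b).coeff 0
      have hq : q.leadingCoeff ≠ 0 := by
        intro h; rw [leadingCoeff_eq_zero] at h; rw [h] at heq; simp at heq; omega
      have hle : (p - C (p.leadingCoeff / q.leadingCoeff) * q).natDegree ≤ p.natDegree := by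
        refine (natDegree_sub_le _ _).trans (max_le le_rfl ?_)
        rw [heq]
        exact natDegree_C_mul_le _ _
      refine lt_of_le_of_ne hle fun hze => ?_
      have h6 : (p - C (p.leadingCoeff / q.leadingCoeff) * q).leadingCoeff = 0 := by
        rw [leadingCoeff, hze, coeff_sub, coeff_C_mul, coeff_natDegree, heq, coeff_natDegree,
          div_mul_cancel₀ _ hq, sub_self]
      rw [leadingCoeff_eq_zero] at h6
      rw [h6] at hze
      simp at hze; omega

end WA

/-- **Theorem 1.4.(1).** Let `C` be a maximal commutative subalgebra of the Weyl algebra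
`A₁` over a field `K` of characteristic zero and let `δ` be a nonzero `K`-derivation of
`C`. The following are equivalent:
(a) `δ` is locally nilpotent on `C`;
(b) there exist `c ∈ C ∖ ker δ` and `n ≥ 2` with `δⁿ(c) = 0`;
(c) `C = K[t]` is a polynomial algebra in one variable `t ∈ C` (i.e. `C` is generated by
a single element `t`, transcendental over `K`) and `δ = d/dt` (the unique derivation with
`δ(t) = 1`). -/
theorem locally_nilpotent_derivation_tfae (K : Type*) [Field K] [CharZero K]
    (C : Subalgebra K (WeylAlgebra K))
    (hComm : ∀ a ∈ C, ∀ b ∈ C, a * b = b * a)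
    (hMax : ∀ C' : Subalgebra K (WeylAlgebra K),
      (∀ a ∈ C', ∀ b ∈ C', a * b = b * a) → C ≤ C' → C' = C)
    (δ : C →ₗ[K] C) (hδ : δ ≠ 0)
    (hLeib : ∀ a b : C, δ (a * b) = a * δ b + δ a * b) :
    ((∀ c : C, ∃ n : ℕ, 1 ≤ n ∧ (δ ^ n) c = 0)
      ↔ ∃ c : C, δ c ≠ 0 ∧ ∃ n : ℕ, 2 ≤ n ∧ (δ ^ n) c = 0)
    ∧ ((∀ c : C, ∃ n : ℕ, 1 ≤ n ∧ (δ ^ n) c = 0)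
      ↔ ∃ t : C, C = Algebra.adjoin K ({(t : WeylAlgebra K)} : Set (WeylAlgebra K))
          ∧ Transcendental K (t : WeylAlgebra K) ∧ δ t = 1) := by
  obtain ⟨deg, h1, h2, h3, h4, h5⟩ := WA.exists_deg C hComm
  letI inst : CommRing C :=
    { (inferInstance : Ring C) with mul_comm := fun a b => Subtype.ext (hComm a a.2 b b.2) }
  have hD : DegFun K C (fun c : C => deg (c : WeylAlgebra K)) :=
    { nz := fun a b ha hb h => (WA.phi_mul_nat (a : WeylAlgebra K) b
        (fun h => ha (Subtype.ext h)) (fun h => hb (Subtype.ext h))).1 (congrArg Subtype.val h)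
      mul := fun a b ha hb => h1 a a.2 b b.2
        (fun h => ha (Subtype.ext h)) (fun h => hb (Subtype.ext h))
      add := fun a b => h2 a a.2 b b.2
      scal := fun k => h3 k
      scal' := fun a ha => by
        obtain ⟨k, hk⟩ := h4 a a.2 ha
        exact ⟨k, Subtype.ext hk⟩
      gr := fun a b ha hab => h5 a a.2 b b.2 ha hab }
  have hae : ∀ (t : C) (p : K[X]), ((aeval t p : C) : WeylAlgebra K) = aeval (t : WeylAlgebra K) p :=
    fun t p => (aeval_algHom_apply C.val t p).symm
  have hab : (∀ c : C, ∃ n : ℕ, 1 ≤ n ∧ (δ ^ n) c = 0) →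
      ∃ c : C, δ c ≠ 0 ∧ ∃ n : ℕ, 2 ≤ n ∧ (δ ^ n) c = 0 := by
    intro h
    obtain ⟨c, hc⟩ : ∃ c, δ c ≠ 0 := by
      by_contra! hcon
      exact hδ (LinearMap.ext hcon)
    obtain ⟨n, hn, hn0⟩ := h c
    refine ⟨c, hc, n, ?_, hn0⟩
    by_contra hlt
    obtain rfl : n = 1 := by omega
    exact hc (by simpa using hn0)
  have hbc : (∃ c : C, δ c ≠ 0 ∧ ∃ n : ℕ, 2 ≤ n ∧ (δ ^ n) c = 0) →
      ∃ t : C, C = Algebra.adjoin K ({(t : WeylAlgebra K)} : Set (WeylAlgebra K))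
          ∧ Transcendental K (t : WeylAlgebra K) ∧ δ t = 1 := by
    intro hb
    obtain ⟨t, ht, ht1⟩ := hD.main hLeib hδ hb
    refine ⟨t, le_antisymm ?_ ?_, ?_, ht1⟩
    · intro c hc
      obtain ⟨p, hp⟩ := ht ⟨c, hc⟩
      rw [Algebra.adjoin_singleton_eq_range_aeval]
      exact ⟨p, (hae t p).symm.trans (congrArg Subtype.val hp).symm⟩
    · rw [Algebra.adjoin_le_iff, Set.singleton_subset_iff]
      exact t.2
    · have := DegFun.transc hLeib hδ t ht1
      rw [transcendental_iff] at this ⊢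
      intro p hp
      exact this p (Subtype.ext ((hae t p).trans hp))
  have hca : (∃ t : C, C = Algebra.adjoin K ({(t : WeylAlgebra K)} : Set (WeylAlgebra K))
          ∧ Transcendental K (t : WeylAlgebra K) ∧ δ t = 1) →
      ∀ c : C, ∃ n : ℕ, 1 ≤ n ∧ (δ ^ n) c = 0 := by
    rintro ⟨t, hCt, -, ht1⟩ c
    have hc : (c : WeylAlgebra K) ∈ Algebra.adjoin K ({(t : WeylAlgebra K)} : Set (WeylAlgebra K)) :=
      hCt ▸ c.2
    rw [Algebra.adjoin_singleton_eq_range_aeval] at hc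
    obtain ⟨p, hp⟩ := hc
    have : c = aeval t p := Subtype.ext (hp.symm.trans (hae t p).symm)
    rw [this]
    exact DegFun.c_a hLeib t ht1 p
  exact ⟨⟨hab, fun h => hca (hbc h)⟩, ⟨fun h => hbc (hab h), hca⟩⟩
end

section
/- Let C be a maximal commutative subalgebra of the first Weyl algebra A₁ over a field K of characteristic zero and let δ be a nonzero K-derivation of C. Then ker(δ) = K. -/
section Helpers

open Polynomial

variable {K : Type*} [Field K]

noncomputable def wD (K : Type*) [Field K] : K[X][X] →ₗ[K] K[X][X] :=
  Polynomial.lsum fun n => ((monomial n : K[X] →ₗ[K[X]] K[X][X]).restrictScalars K) ∘ₗ derivative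

lemma wD_monomial (n : ℕ) (f : K[X]) : wD K (monomial n f) = monomial n (derivative f) := by
  simp [wD, Polynomial.lsum_apply, sum_monomial_index]

lemma wD_coeff (p : K[X][X]) (n : ℕ) : (wD K p).coeff n = derivative (p.coeff n) := by
  induction p using Polynomial.induction_on' with
  | add p q hp hq => simp [hp, hq]
  | monomial m f =>
    rw [wD_monomial, coeff_monomial, coeff_monomial]
    split_ifs <;> simp

lemma wD_X_mul (p : K[X][X]) : wD K (X * p) = X * wD K p := by
  ext1 n
  rw [wD_coeff]
  cases n with
  | zero => simp
  | succ n => rw [coeff_X_mul, coeff_X_mul, wD_coeff]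

lemma wD_X_pow_mul (j : ℕ) (p : K[X][X]) : wD K (X ^ j * p) = X ^ j * wD K p := by
  induction j with
  | zero => simp
  | succ j ih => rw [pow_succ', mul_assoc, wD_X_mul, ih, mul_assoc]

lemma wD_natCast_mul (j : ℕ) (p : K[X][X]) : wD K ((j : K[X][X]) * p) = j * wD K p := by
  rw [← nsmul_eq_mul, map_nsmul, nsmul_eq_mul]

lemma wD_C_mul (f : K[X]) (p : K[X][X]) :
    wD K (C f * p) = C (derivative f) * p + C f * wD K p := by
  ext1 n
  simp only [wD_coeff, coeff_add, coeff_C_mul, derivative_mul]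

/-- The action of `Y`. -/
noncomputable def wY (K : Type*) [Field K] : K[X][X] →ₗ[K] K[X][X] :=
  LinearMap.mulLeft K (X : K[X][X]) + wD K

/-- The action of `X`. -/
noncomputable def wX (K : Type*) [Field K] : K[X][X] →ₗ[K] K[X][X] :=
  LinearMap.mulLeft K (C X : K[X][X])

lemma wY_apply (p : K[X][X]) : wY K p = X * p + wD K p := rfl
lemma wX_apply (p : K[X][X]) : wX K p = C X * p := rfl

lemma wYX : wY K * wX K = wX K * wY K + 1 := by
  ext1 p
  simp only [Module.End.mul_apply, LinearMap.add_apply, Module.End.one_apply, wY_apply, wX_apply,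
    wD_C_mul, derivative_X, C_1]
  ring

noncomputable def rho (K : Type*) [Field K] : WeylAlgebra K →ₐ[K] Module.End K K[X][X] :=
  RingQuot.liftAlgHom K ⟨FreeAlgebra.lift K ![wX K, wY K], by
    rintro a b ⟨rfl, rfl⟩
    simpa using wYX⟩

noncomputable def gx (K : Type*) [Field K] : WeylAlgebra K :=
  RingQuot.mkAlgHom K (weylRel K) (FreeAlgebra.ι K 0)
noncomputable def gy (K : Type*) [Field K] : WeylAlgebra K :=
  RingQuot.mkAlgHom K (weylRel K) (FreeAlgebra.ι K 1)

lemma rho_gx : rho K (gx K) = wX K := by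
  rw [rho, gx, RingQuot.liftAlgHom_mkAlgHom_apply]; simp
lemma rho_gy : rho K (gy K) = wY K := by
  rw [rho, gy, RingQuot.liftAlgHom_mkAlgHom_apply]; simp

lemma gyx : gy K * gx K = gx K * gy K + 1 := by
  have := RingQuot.mkAlgHom_rel K (s := weylRel K) ⟨rfl, rfl⟩
  simp only [map_mul, map_add, map_one] at this
  exact this

lemma weyl_induction {P : WeylAlgebra K → Prop} (hK : ∀ k, P (algebraMap K _ k))
    (hx : P (gx K)) (hy : P (gy K)) (hm : ∀ a b, P a → P b → P (a * b))
    (ha : ∀ a b, P a → P b → P (a + b)) (a : WeylAlgebra K) : P a := by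
  obtain ⟨a, rfl⟩ := RingQuot.mkAlgHom_surjective K (weylRel K) a
  induction a using FreeAlgebra.induction with
  | grade0 k => simpa using hK k
  | grade1 i => fin_cases i; exacts [hx, hy]
  | mul a b h1 h2 => rw [map_mul]; exact hm _ _ h1 h2
  | add a b h1 h2 => rw [map_add]; exact ha _ _ h1 h2

noncomputable def psi (K : Type*) [Field K] : K[X][X] →ₗ[K] WeylAlgebra K :=
  Polynomial.lsum fun n => LinearMap.mulRight K (gy K ^ n) ∘ₗ (aeval (gx K)).toLinearMap

lemma psi_monomial (n : ℕ) (f : K[X]) : psi K (monomial n f) = aeval (gx K) f * gy K ^ n := by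
  simp [psi, Polynomial.lsum_apply, sum_monomial_index]

lemma gy_aeval (f : K[X]) :
    gy K * aeval (gx K) f = aeval (gx K) f * gy K + aeval (gx K) (derivative f) := by
  induction f using Polynomial.induction_on with
  | C k => simp [Algebra.commutes]
  | add p q hp hq => simp only [map_add, mul_add, add_mul, hp, hq]; abel
  | monomial n k ih =>
    have e : (C k * X ^ (n + 1) : K[X]) = X * (C k * X ^ n) := by ring
    rw [e, map_mul, aeval_X, ← mul_assoc, gyx, add_mul, mul_assoc, ih,
      derivative_mul (f := (X : K[X])), derivative_X, one_mul, map_add, map_mul (aeval (gx K)) X,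
      aeval_X]
    noncomm_ring

lemma psi_wX (p : K[X][X]) : psi K (wX K p) = gx K * psi K p := by
  rw [wX_apply]
  induction p using Polynomial.induction_on' with
  | add p q hp hq => rw [mul_add, map_add, hp, hq, map_add, mul_add]
  | monomial n f => rw [C_mul_monomial, psi_monomial, psi_monomial, map_mul, aeval_X, mul_assoc]

lemma psi_wY (p : K[X][X]) : psi K (wY K p) = gy K * psi K p := by
  induction p using Polynomial.induction_on' with
  | add p q hp hq => rw [map_add, map_add, map_add, mul_add, hp, hq]
  | monomial n f =>
    rw [wY_apply, X_mul_monomial, map_add, wD_monomial, psi_monomial, psi_monomial, psi_monomial,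
      ← mul_assoc, gy_aeval, add_mul, pow_succ', mul_assoc]

lemma psi_rho (a : WeylAlgebra K) : ∀ p, psi K (rho K a p) = a * psi K p := by
  induction a using weyl_induction with
  | hK k => intro p; rw [AlgHom.commutes, Module.algebraMap_end_apply, map_smul, Algebra.smul_def]
  | hm a b h1 h2 => intro p; rw [map_mul, Module.End.mul_apply, h1, h2, mul_assoc]
  | ha a b h1 h2 => intro p; rw [map_add, LinearMap.add_apply, map_add, h1, h2, add_mul]
  | hx => intro p; rw [rho_gx, psi_wX]
  | hy => intro p; rw [rho_gy, psi_wY]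

/-- the normal form -/
noncomputable def phi (a : WeylAlgebra K) : K[X][X] := rho K a 1

lemma phi_add (a b : WeylAlgebra K) : phi (a + b) = phi a + phi b := by simp [phi]
lemma phi_smul (k : K) (b : WeylAlgebra K) : phi (k • b) = k • phi b := by simp [phi]
lemma phi_one : phi (1 : WeylAlgebra K) = 1 := by simp [phi]
lemma phi_zero : phi (0 : WeylAlgebra K) = 0 := by simp [phi]
lemma phi_algebraMap (k : K) : phi (algebraMap K (WeylAlgebra K) k) = C (C k) := by
  rw [Algebra.algebraMap_eq_smul_one, phi_smul, phi_one]
  ext1 n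
  simp [coeff_smul, coeff_one, coeff_C, smul_eq_C_mul]

lemma psi_phi (a : WeylAlgebra K) : psi K (phi a) = a := by
  rw [phi, psi_rho, ← monomial_zero_one, psi_monomial]; simp

lemma phi_inj {a b : WeylAlgebra K} (h : phi a = phi b) : a = b := by
  rw [← psi_phi a, h, psi_phi]

lemma rho_aeval (f : K[X]) (q : K[X][X]) : rho K (aeval (gx K) f) q = C f * q := by
  induction f using Polynomial.induction_on generalizing q with
  | C k =>
    rw [aeval_C, AlgHom.commutes, Module.algebraMap_end_apply]
    ext1 n
    simp [smul_eq_C_mul]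
  | add p r hp hr => simp only [map_add, LinearMap.add_apply, hp, hr, add_mul]
  | monomial n k ih =>
    have e : (C k * X ^ (n + 1) : K[X]) = X * (C k * X ^ n) := by ring
    rw [e, map_mul, aeval_X, map_mul, Module.End.mul_apply, ih, rho_gx, wX_apply, C_mul (a := X),
      mul_assoc]

lemma wY_pow (q : K[X][X]) (m : ℕ) (hq : q.natDegree ≤ m) (j : ℕ) :
    ∃ E : K[X][X], (wY K ^ j) q = X ^ j * q + derivative (X ^ j) * wD K q + E ∧
      ∀ k, j + m ≤ k + 1 → E.coeff k = 0 := by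
  induction j with
  | zero => exact ⟨0, by simp, by simp⟩
  | succ j ih =>
    obtain ⟨E, hE, hk⟩ := ih
    refine ⟨derivative (X ^ j) * wD K (wD K q) + X * E + wD K E, ?_, ?_⟩
    · rw [pow_succ', Module.End.mul_apply, hE, wY_apply]
      simp only [map_add, wD_X_pow_mul, derivative_X_pow, C_eq_natCast, mul_assoc, wD_natCast_mul]
      rw [Nat.add_sub_cancel]
      rcases j with _ | j
      · simp; ring
      · rw [Nat.add_sub_cancel]; push_cast; ring
    · intro k h
      have h1 : (derivative (X ^ j : K[X][X]) * wD K (wD K q)).coeff k = 0 := by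
        rcases j with _ | j
        · simp
        · rw [derivative_X_pow, mul_assoc, coeff_C_mul, Nat.add_sub_cancel, coeff_X_pow_mul',
            if_pos (by omega), wD_coeff, wD_coeff, coeff_eq_zero_of_natDegree_lt (by omega)]
          simp
      have h2 : (X * E).coeff k = 0 := by
        rcases k with _ | k
        · simp
        · rw [coeff_X_mul, hk _ (by omega)]
      rw [coeff_add, coeff_add, h1, h2, wD_coeff, hk _ (by omega)]
      simp

lemma rho_psi_star (q : K[X][X]) (m : ℕ) (hq : q.natDegree ≤ m) (n : ℕ) (p : K[X][X])
    (hp : p.natDegree ≤ n) (k : ℕ) (hk : n + m ≤ k + 1) :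
    (rho K (psi K p) q).coeff k = (p * q + derivative p * wD K q).coeff k := by
  refine Polynomial.induction_with_natDegree_le (fun p => (rho K (psi K p) q).coeff k =
    (p * q + derivative p * wD K q).coeff k) n ?_ ?_ ?_ p hp
  · simp
  · intro j f hf hj
    obtain ⟨E, hE, hc⟩ := wY_pow q m hq j
    rw [C_mul_X_pow_eq_monomial, psi_monomial, map_mul, map_pow, Module.End.mul_apply, rho_gy, hE,
      rho_aeval, ← C_mul_X_pow_eq_monomial, derivative_C_mul, mul_add, coeff_add,
      coeff_C_mul (p := E), hc k (by omega)]
    simp only [mul_zero, add_zero, mul_add, mul_assoc]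
  · intro p r h1 h2 ihp ihr
    simp only [map_add, LinearMap.add_apply, add_mul, coeff_add] at *
    rw [ihp, ihr]; ring

lemma phi_mul_coeff (a b : WeylAlgebra K) (n m : ℕ) (ha : (phi a).natDegree ≤ n)
    (hb : (phi b).natDegree ≤ m) (k : ℕ) (hk : n + m ≤ k + 1) :
    (phi (a * b)).coeff k = (phi a * phi b + derivative (phi a) * wD K (phi b)).coeff k := by
  rw [← rho_psi_star (phi b) m hb n (phi a) ha k hk, psi_phi, phi, map_mul]
  rfl


lemma wD_natDegree (q : K[X][X]) (m : ℕ) (hq : q.natDegree ≤ m) : (wD K q).natDegree ≤ m := by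
  rw [natDegree_le_iff_coeff_eq_zero]
  intro k hk
  rw [wD_coeff, coeff_eq_zero_of_natDegree_lt (by omega), derivative_zero]

lemma dcoeff (p q : K[X][X]) (n m : ℕ) (hp : p.natDegree ≤ n) (hq : q.natDegree ≤ m) (k : ℕ)
    (hk : k + 1 = n + m) :
    (derivative p * wD K q).coeff k = n * p.coeff n * derivative (q.coeff m) := by
  rcases n with _ | n
  · rw [eq_C_of_natDegree_le_zero hp]; simp
  · obtain rfl : k = n + m := by omega
    rw [coeff_mul_add_eq_of_natDegree_le _ (wD_natDegree q m hq), coeff_derivative, wD_coeff]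
    · push_cast; ring
    · exact (natDegree_derivative_le p).trans (by omega)

lemma dcoeff_top (p q : K[X][X]) (n m : ℕ) (hp : p.natDegree ≤ n) (hq : q.natDegree ≤ m) (k : ℕ)
    (hk : n + m ≤ k) : (derivative p * wD K q).coeff k = 0 := by
  rcases n with _ | n
  · rw [eq_C_of_natDegree_le_zero hp]; simp
  · apply coeff_eq_zero_of_natDegree_lt
    have h1 := natDegree_mul_le (p := derivative p) (q := wD K q)
    have h2 := natDegree_derivative_le p
    have h3 := wD_natDegree q m hq
    omega

lemma phi_mul_coeff_top (a b : WeylAlgebra K) (n m : ℕ) (ha : (phi a).natDegree ≤ n)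
    (hb : (phi b).natDegree ≤ m) (k : ℕ) (hk : n + m ≤ k) :
    (phi (a * b)).coeff k = (phi a * phi b).coeff k := by
  rw [phi_mul_coeff a b n m ha hb k (by omega), coeff_add, dcoeff_top _ _ n m ha hb k hk, add_zero]

lemma phi_mul_natDegree_le (a b : WeylAlgebra K) :
    (phi (a * b)).natDegree ≤ (phi a).natDegree + (phi b).natDegree := by
  rw [natDegree_le_iff_coeff_eq_zero]
  intro k hk
  rw [phi_mul_coeff_top a b _ _ le_rfl le_rfl k hk.le]
  exact coeff_eq_zero_of_natDegree_lt (natDegree_mul_le.trans_lt hk)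

lemma phi_ne {a : WeylAlgebra K} (ha : a ≠ 0) : phi a ≠ 0 := fun h => ha (phi_inj (h.trans phi_zero.symm))

lemma phi_mul_lead {a b : WeylAlgebra K} (ha : a ≠ 0) (hb : b ≠ 0) :
    (phi (a * b)).coeff ((phi a).natDegree + (phi b).natDegree) ≠ 0 := by
  rw [phi_mul_coeff_top a b _ _ le_rfl le_rfl _ le_rfl, coeff_mul_degree_add_degree]
  exact mul_ne_zero (leadingCoeff_ne_zero.mpr (phi_ne ha)) (leadingCoeff_ne_zero.mpr (phi_ne hb))

lemma weyl_mul_ne {a b : WeylAlgebra K} (ha : a ≠ 0) (hb : b ≠ 0) : a * b ≠ 0 := by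
  intro h
  apply phi_mul_lead ha hb
  rw [h, phi_zero, coeff_zero]

lemma weyl_commute {a b : WeylAlgebra K} (h : a * b = b * a) :
    ((phi a).natDegree : K[X]) * (phi a).leadingCoeff * derivative (phi b).leadingCoeff =
      ((phi b).natDegree : K[X]) * (phi b).leadingCoeff * derivative (phi a).leadingCoeff := by
  rcases Nat.eq_zero_or_pos ((phi a).natDegree + (phi b).natDegree) with h0 | h0
  · have h1 : (phi a).natDegree = 0 := by omega
    have h2 : (phi b).natDegree = 0 := by omega
    simp [h1, h2]
  · obtain ⟨k, hk⟩ := Nat.exists_eq_succ_of_ne_zero h0.ne'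
    have e1 := phi_mul_coeff a b _ _ le_rfl le_rfl k hk.le
    have e2 := phi_mul_coeff b a _ _ le_rfl le_rfl k (by omega)
    rw [coeff_add, dcoeff _ _ _ _ le_rfl le_rfl k hk.symm] at e1
    rw [coeff_add, dcoeff _ _ _ _ le_rfl le_rfl k (by omega), ← h, e1, mul_comm (phi b)] at e2
    exact add_left_cancel e2

lemma phi_mul_zero {a b : WeylAlgebra K} (ha : (phi a).natDegree = 0) (hb : (phi b).natDegree = 0) :
    (phi (a * b)).coeff 0 = (phi a).coeff 0 * (phi b).coeff 0 := by
  rw [phi_mul_coeff_top a b 0 0 ha.le hb.le 0 le_rfl, mul_coeff_zero]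

lemma weyl_scalar {a : WeylAlgebra K} (ha : (phi a).natDegree = 0)
    (h : ((phi a).coeff 0).natDegree = 0) : ∃ k, algebraMap K _ k = a := by
  refine ⟨((phi a).coeff 0).coeff 0, phi_inj ?_⟩
  rw [phi_algebraMap, ← eq_C_of_natDegree_eq_zero h, ← eq_C_of_natDegree_eq_zero ha]

lemma weyl_unit {a b : WeylAlgebra K} (h : a * b = 1) : ∃ k, algebraMap K _ k = a := by
  have h1 : (1 : WeylAlgebra K) ≠ 0 := by
    intro h; have := congrArg phi h; rw [phi_one, phi_zero] at this; exact one_ne_zero this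
  have ha : a ≠ 0 := by rintro rfl; rw [zero_mul] at h; exact h1 h.symm
  have hb : b ≠ 0 := by rintro rfl; rw [mul_zero] at h; exact h1 h.symm
  have h2 := phi_mul_lead ha hb
  have h3 := le_natDegree_of_ne_zero h2
  rw [h, phi_one, natDegree_one] at h3
  have h4 := phi_mul_zero (a := a) (b := b) (by omega) (by omega)
  rw [h, phi_one, coeff_one_zero] at h4
  exact weyl_scalar (by omega) (natDegree_eq_zero_of_isUnit (IsUnit.of_mul_eq_one _ h4.symm))

lemma root_lemma [CharZero K] {n m : ℕ} (hn : n ≠ 0) {f g : K[X]} (hg : g ≠ 0)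
    (h : (n : K[X]) * f * derivative g = (m : K[X]) * g * derivative f) (x : K)
    (hf : f.eval x ≠ 0) : g.eval x ≠ 0 := by
  intro hx
  have hg' : derivative g ≠ 0 := by
    intro h0
    have := derivative_eq_zero.mp h0
    rw [eq_C_of_natDegree_eq_zero this] at hx hg
    simp at hx
    simp [hx] at hg
  have hf0 : f ≠ 0 := by rintro rfl; simp at hf
  have hl : (n : K[X]) * f * derivative g ≠ 0 :=
    mul_ne_zero (mul_ne_zero (by exact_mod_cast hn) hf0) hg'
  have hd : (X - C x) ^ (g.rootMultiplicity x) ∣ (n : K[X]) * f * derivative g := by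
    rw [h]
    exact ((pow_rootMultiplicity_dvd g x).mul_left _).mul_right _
  have hc : IsCoprime ((X - C x) ^ (g.rootMultiplicity x)) ((n : K[X]) * f) := by
    apply IsCoprime.pow_left
    rw [(irreducible_X_sub_C x).coprime_iff_not_dvd, dvd_iff_isRoot]
    simp [hf, hn]
  have h1 := hc.dvd_of_dvd_mul_left hd
  have h2 := (le_rootMultiplicity_iff hg').mpr h1
  rw [derivative_rootMultiplicity_of_root hx] at h2
  have h3 := (rootMultiplicity_pos hg).mpr hx
  omega

/-- The key linear map. -/
lemma key_map [CharZero K] (c : WeylAlgebra K) (hc : ¬ ∃ k, algebraMap K _ k = c) :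
    ∃ L : WeylAlgebra K →ₗ[K] K[X], (∀ b, b * c = c * b → L b = 0 → b = 0) ∧
      ∃ w : WeylAlgebra K → ℕ, w 1 = 0 ∧
        ∀ a b, a * c = c * a → b * c = c * b → w (a * b) ≤ w a + w b ∧
          (L a).natDegree ≤ w a := by
  have hc0 : c ≠ 0 := by
    rintro rfl; exact hc ⟨0, map_zero _⟩
  by_cases hn : (phi c).natDegree = 0
  · have hz : ∀ b, b * c = c * b → (phi b).natDegree = 0 := by
      intro b hb
      have h := weyl_commute hb
      rw [hn] at h
      by_contra hb0
      have h1 : phi b ≠ 0 := by intro h; simp [h] at hb0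
      have h2 : derivative (phi c).leadingCoeff ≠ 0 := by
        intro h3
        refine hc (weyl_scalar hn ?_)
        rw [leadingCoeff, hn] at h3
        exact derivative_eq_zero.mp h3
      rw [Nat.cast_zero, zero_mul, zero_mul] at h
      exact mul_ne_zero (mul_ne_zero (by exact_mod_cast hb0) (leadingCoeff_ne_zero.mpr h1)) h2 h
    refine ⟨((lcoeff K[X] 0).restrictScalars K) ∘ₗ ⟨⟨phi, phi_add⟩, phi_smul⟩, ?_,
      fun b => ((phi b).coeff 0).natDegree, ?_, ?_⟩
    · intro b hb h
      change (phi b).coeff 0 = 0 at h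
      apply phi_inj
      rw [eq_C_of_natDegree_eq_zero (hz b hb), h, phi_zero, C_0]
    · simp [phi_one]
    · intro a b ha hb
      refine ⟨?_, le_rfl⟩
      beta_reduce
      rw [phi_mul_zero (hz a ha) (hz b hb)]
      exact natDegree_mul_le
  · obtain ⟨x, hx⟩ : ∃ x, (phi c).leadingCoeff.eval x ≠ 0 := by
      by_contra! h
      exact phi_ne hc0 (leadingCoeff_eq_zero.mp (funext fun x => by rw [h x, eval_zero]))
    refine ⟨(mapAlgHom (aeval x : K[X] →ₐ[K] K)).toLinearMap ∘ₗ ⟨⟨phi, phi_add⟩, phi_smul⟩, ?_,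
      fun b => (phi b).natDegree, ?_, ?_⟩
    · intro b hb h
      by_contra hb0
      have h1 := root_lemma hn (leadingCoeff_ne_zero.mpr (phi_ne hb0)) (weyl_commute hb.symm) x hx
      have h2 := congrArg (fun p => p.coeff (phi b).natDegree) h
      apply h1
      simpa [coeff_map, coe_aeval_eq_eval] using h2
    · simp [phi_one]
    · intro a b ha hb
      exact ⟨phi_mul_natDegree_le a b, natDegree_map_le⟩

lemma alg_lemma {S : Type*} [CommRing S] [Algebra K S] (a c : S) (hc : Transcendental K c)
    (L : S →ₗ[K] K[X]) (hL : ∀ b, L b = 0 → b = 0) (d : ℕ)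
    (hd : ∀ i j, (L (a ^ i * c ^ j)).natDegree ≤ (i + j) * d) (S0 : Subalgebra K S) (hS0 : c ∈ S0) :
    IsAlgebraic S0 a := by
  obtain ⟨N, hN⟩ : ∃ N, N = 2 * d + 2 := ⟨_, rfl⟩
  let v : Fin N × Fin N → degreeLT K (2 * N * d + 1) := fun ij =>
    ⟨L (a ^ (ij.1 : ℕ) * c ^ (ij.2 : ℕ)), by
      rw [mem_degreeLT]
      refine degree_le_natDegree.trans_lt ?_
      have h1 := hd ij.1 ij.2
      have h2 : ((ij.1 : ℕ) + ij.2) * d ≤ 2 * N * d := Nat.mul_le_mul_right _ (by omega)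
      exact_mod_cast (by omega)⟩
  have hv : ¬ LinearIndependent K v := by
    intro h
    have hf : Module.Finite K (degreeLT K (2 * N * d + 1)) :=
      Module.Finite.equiv (degreeLTEquiv K _).symm
    have h1 := h.fintype_card_le_finrank
    rw [(degreeLTEquiv K _).finrank_eq] at h1
    simp at h1
    subst hN
    nlinarith
  rw [Fintype.linearIndependent_iff] at hv
  push Not at hv
  obtain ⟨l, hl, ⟨i0, j0⟩, hne⟩ := hv
  have hs : ∑ ij : Fin N × Fin N, l ij • (a ^ (ij.1 : ℕ) * c ^ (ij.2 : ℕ)) = 0 := by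
    apply hL
    rw [map_sum]
    have := congrArg Subtype.val hl
    simpa [v] using this
  let c0 : S0 := ⟨c, hS0⟩
  let r : Fin N → S0 := fun i => aeval c0 (∑ j : Fin N, monomial (j : ℕ) (l (i, j)))
  refine ⟨∑ i : Fin N, monomial (i : ℕ) (r i), ?_, ?_⟩
  · intro h
    have h1 := congrArg (fun p => p.coeff (i0 : ℕ)) h
    simp only [finsetSum_coeff, coeff_monomial, coeff_zero, Fin.val_inj, Finset.sum_ite_eq',
      Finset.mem_univ, if_true] at h1
    have h2 : aeval c (∑ j : Fin N, monomial (j : ℕ) (l (i0, j))) = 0 := by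
      have := congrArg S0.val h1
      rw [map_zero, ← Polynomial.aeval_algHom_apply] at this
      exact this
    have h3 := (transcendental_iff.mp hc) _ h2
    have h4 := congrArg (fun p => p.coeff (j0 : ℕ)) h3
    simp only [finsetSum_coeff, coeff_monomial, coeff_zero, Fin.val_inj, Finset.sum_ite_eq',
      Finset.mem_univ, if_true] at h4
    exact hne h4
  · rw [← hs, Fintype.sum_prod_type, map_sum]
    refine Finset.sum_congr rfl fun i _ => ?_
    have h2 : algebraMap S0 S (r i) = aeval c (∑ j : Fin N, monomial (j : ℕ) (l (i, j))) := by
      change S0.val (r i) = _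
      rw [← Polynomial.aeval_algHom_apply]; rfl
    rw [aeval_monomial, h2, map_sum, Finset.sum_mul]
    refine Finset.sum_congr rfl fun j _ => ?_
    rw [aeval_monomial, Algebra.smul_def]
    ring

lemma der_lemma {R S : Type*} [CommRing R] [CommRing S] [IsDomain S] [CharZero R] [Algebra R S]
    [IsDomain R] (hi : Function.Injective (algebraMap R S)) (D : Derivation R S S) (a : S) (ha : IsAlgebraic R a) : D a = 0 := by
  obtain ⟨p, hp, hpa⟩ := ha
  induction h : p.natDegree using Nat.strong_induction_on generalizing p with
  | _ n ih =>
    have h1 := D.map_aeval p a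
    rw [hpa, map_zero, eq_comm, smul_eq_mul, mul_eq_zero] at h1
    rcases h1 with h1 | h1
    · have h3 : p.natDegree ≠ 0 := by
        intro h0
        rw [eq_C_of_natDegree_eq_zero h0] at hpa hp
        rw [aeval_C] at hpa
        rw [hi (hpa.trans (map_zero _).symm), C_0] at hp
        exact hp rfl
      exact ih _ (h ▸ natDegree_derivative_lt h3) (derivative p)
        (fun h4 => h3 (derivative_eq_zero.mp h4)) h1 rfl
    · exact h1

end Helpers

/-- **Theorem 1.4.(3).** Let `C` be a maximal commutative subalgebra of the Weyl algebra
`A₁` over a field `K` of characteristic zero and let `δ` be a nonzero `K`-derivation of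
`C` (a `K`-linear map satisfying the Leibniz rule). Then `ker δ = K`. -/
theorem ker_derivation_eq_scalars (K : Type*) [Field K] [CharZero K]
    (C : Subalgebra K (WeylAlgebra K))
    (hComm : ∀ a ∈ C, ∀ b ∈ C, a * b = b * a)
    (hMax : ∀ C' : Subalgebra K (WeylAlgebra K),
      (∀ a ∈ C', ∀ b ∈ C', a * b = b * a) → C ≤ C' → C' = C)
    (δ : C →ₗ[K] C) (hδ : δ ≠ 0)
    (hLeib : ∀ a b : C, δ (a * b) = a * δ b + δ a * b) :
    ∀ c : C, δ c = 0 ↔ c ∈ Set.range (algebraMap K C) := by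
  let _ : CommRing C := { (inferInstance : Ring C) with
    mul_comm := fun a b => Subtype.ext (hComm a a.2 b b.2) }
  have hnt : Nontrivial C := by
    by_contra h
    rw [not_nontrivial_iff_subsingleton] at h
    exact hδ (LinearMap.ext fun c => Subsingleton.elim _ _)
  have : NoZeroDivisors C := ⟨by
    intro a b h
    by_contra! h'
    refine weyl_mul_ne (a := (a : WeylAlgebra K)) (b := b) ?_ ?_ (congrArg Subtype.val h)
    · exact fun h0 => h'.1 (Subtype.ext h0)
    · exact fun h0 => h'.2 (Subtype.ext h0)⟩
  have : IsDomain C := NoZeroDivisors.to_isDomain C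
  have hone : δ 1 = 0 := by
    have := hLeib 1 1
    rw [mul_one, one_mul, mul_one] at this
    exact left_eq_add.mp this
  have hsc : ∀ k : K, δ (algebraMap K C k) = 0 := by
    intro k
    rw [Algebra.algebraMap_eq_smul_one, map_smul, hone, smul_zero]
  intro c
  refine ⟨fun hc => ?_, ?_⟩
  swap
  · rintro ⟨k, rfl⟩
    exact hsc k
  by_contra hns
  have hns' : ¬ ∃ k, algebraMap K (WeylAlgebra K) k = c := by
    rintro ⟨k, hk⟩
    exact hns ⟨k, Subtype.ext hk⟩
  have htr : Transcendental K c := by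
    intro halg
    have hc0 : c ≠ 0 := by
      rintro rfl
      exact hns ⟨0, map_zero _⟩
    have hu := IsArtinianRing.isUnit_of_isIntegral_of_nonZeroDivisor halg.isIntegral
      (mem_nonZeroDivisors_of_ne_zero hc0)
    obtain ⟨u, hu⟩ := hu.exists_right_inv
    exact hns' (weyl_unit (congrArg Subtype.val hu))
  let S0 : Subalgebra K C :=
    { carrier := {a | δ a = 0}
      mul_mem' := by
        intro a b ha hb
        simp only [Set.mem_ofPred_eq] at *
        rw [hLeib, ha, hb, mul_zero, zero_mul, add_zero]
      add_mem' := by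
        intro a b ha hb
        simp only [Set.mem_ofPred_eq] at *
        rw [map_add, ha, hb, add_zero]
      algebraMap_mem' := hsc }
  let D : Derivation S0 C C := Derivation.mk'
    { toFun := δ
      map_add' := map_add δ
      map_smul' := by
        intro s a
        have h : δ (s : C) = 0 := s.2
        change δ ((s : C) * a) = (s : C) * δ a
        rw [hLeib, h, zero_mul, add_zero] } (by
      intro a b
      change δ (a * b) = a * δ b + b * δ a
      rw [hLeib, mul_comm b])
  obtain ⟨L, hL, w, hw1, hw⟩ := key_map (c : WeylAlgebra K) hns'
  have hcm : ∀ a : C, (a : WeylAlgebra K) * c = c * a := fun a => hComm a a.2 c c.2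
  have hpow : ∀ (a : C) (i : ℕ), w ((a ^ i : C) : WeylAlgebra K) ≤ i * w a := by
    intro a i
    induction i with
    | zero => rw [pow_zero]; exact (le_of_eq hw1).trans (Nat.zero_le _)
    | succ i ih =>
      have := (hw ((a ^ i : C) : WeylAlgebra K) a (hcm _) (hcm _)).1
      rw [pow_succ, add_mul, one_mul]
      exact this.trans (Nat.add_le_add_right ih _)
  have : CharZero S0 := charZero_of_injective_algebraMap (algebraMap K S0).injective
  apply hδ
  ext1 a
  refine der_lemma (R := S0) Subtype.val_injective D a ?_
  refine alg_lemma a c htr (L ∘ₗ C.val.toLinearMap) ?_ (w a + w c) ?_ S0 hc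
  · intro b hb
    exact Subtype.ext (hL b (hcm b) hb)
  · intro i j
    have h1 := (hw ((a ^ i * c ^ j : C) : WeylAlgebra K) 1 (hcm _) (by simp)).2
    have h2 := (hw ((a ^ i : C) : WeylAlgebra K) ((c ^ j : C) : WeylAlgebra K) (hcm _) (hcm _)).1
    have h3 := hpow a i
    have h4 := hpow c j
    refine h1.trans (h2.trans ?_)
    nlinarith
end
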